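/- arXiv:1211.1247 — 3 statements merged into one kernel-verified Lean document; each statement's English description precedes it below -/
import Mathlib

section
/- Let G be a finite, regular, connected, non-bipartite graph and let α = 1. Then the random vector x(n) of proportions of balls converges almost surely to the uniform measure (1/m, …, 1/m) as n → ∞. -/
open MeasureTheory Filter Topology

open MeasureTheory Filter Topology

/-- A generalized Pólya urn process with graph based interactions on a finite graph `G`
with vertex set `Fin m` and reinforcement exponent `α`, as in Benaïm–Benjamini–Chen–Lima.
`B n i` is the number of balls in bin `i` after step `n`; at each step, for each edge
`{i,j}` of `G` one ball is added to `i` or to `j`, with conditional probability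
`B_i(n)^α / (B_i(n)^α + B_j(n)^α)` for `i`, independently over distinct edges. -/
structure GraphUrn (m : ℕ) (G : SimpleGraph (Fin m)) [DecidableRel G.Adj] (α : ℝ) where
  /-- the underlying sample space -/
  Ω : Type
  /-- the ambient measurable structure -/
  [mΩ : MeasurableSpace Ω]
  /-- the underlying probability measure -/
  μ : Measure Ω
  isProb : IsProbabilityMeasure μ
  /-- `ℱ n` is the sigma-algebra generated by the process up to step `n` -/
  ℱ : Filtration ℕ mΩ
  /-- `B n i ω` is the number of balls in the bin at vertex `i` after step `n` -/
  B : ℕ → Fin m → Ω → ℕ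
  /-- `δ n i j ω = 1` iff at step `n` the ball of the edge `{i,j}` is added to bin `i` -/
  δ : ℕ → Fin m → Fin m → Ω → ℕ
  /-- each bin contains at least one ball initially -/
  B0_pos : ∀ i ω, 1 ≤ B 0 i ω
  /-- the initial configuration is deterministic -/
  B0_det : ∀ i ω ω', B 0 i ω = B 0 i ω'
  /-- on each edge, exactly one of the two endpoints receives the ball -/
  δ_sum : ∀ n i j, G.Adj i j → ∀ ω, δ n i j ω + δ n j i ω = 1
  /-- the evolution of the number of balls in each bin -/
  B_succ : ∀ n i ω, B (n + 1) i ω = B n i ω + ∑ j ∈ G.neighborFinset i, δ (n + 1) i j ω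
  /-- the number of balls after step `n` is measurable with respect to `ℱ n` -/
  B_adapted : ∀ n i, Measurable[ℱ n] (B n i)
  /-- the choices at step `n` are measurable with respect to `ℱ n` -/
  δ_adapted : ∀ n i j, Measurable[ℱ n] (δ n i j)
  /-- conditionally on the past, the ball of the edge `{i,j}` at step `n+1` goes to bin `i`
  with probability `B_i(n)^α / (B_i(n)^α + B_j(n)^α)` -/
  cond_law : ∀ n i j, G.Adj i j →
    μ[fun ω => (δ (n + 1) i j ω : ℝ) | ℱ n] =ᵐ[μ]
      fun ω => (B n i ω : ℝ) ^ α / ((B n i ω : ℝ) ^ α + (B n j ω : ℝ) ^ α)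
  /-- conditionally on the past, the choices on distinct edges are independent -/
  cond_indep : ∀ n (s : Finset (Fin m × Fin m)), (∀ p ∈ s, G.Adj p.1 p.2) →
    (∀ p ∈ s, ∀ q ∈ s, p ≠ q → (s(p.1, p.2) : Sym2 (Fin m)) ≠ s(q.1, q.2)) →
    μ[fun ω => ∏ p ∈ s, (δ (n + 1) p.1 p.2 ω : ℝ) | ℱ n] =ᵐ[μ]
      fun ω => ∏ p ∈ s, (μ[fun ω' => (δ (n + 1) p.1 p.2 ω' : ℝ) | ℱ n]) ω

namespace GraphUrn

variable {m : ℕ} {G : SimpleGraph (Fin m)} [DecidableRel G.Adj] {α : ℝ}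

/-- `x P n ω` is the vector of proportions of balls after step `n`:
`x_i(n) = B_i(n) / (N_0 + n N)` where `N_0` is the initial total number of balls and
`N` is the number of edges of `G`. -/
noncomputable def x (P : GraphUrn m G α) (n : ℕ) (ω : P.Ω) : Fin m → ℝ :=
  fun i => (P.B n i ω : ℝ) / (((∑ j, P.B 0 j ω) + n * G.edgeFinset.card : ℕ) : ℝ)

end GraphUrn


theorem urn_phi_ineq (b d r : ℝ) (hb : 1 ≤ b) (hd : 0 ≤ d) (hdr : d ≤ r) :
    d / b ≤ (Real.log (b + d) - r / (b + d)) - (Real.log b - r / b) := by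
  have hb0 : 0 < b := by linarith
  have h1 := Real.le_log_one_add_of_nonneg (x := d / b) (by positivity)
  have h2 : Real.log (b + d) = Real.log b + Real.log (1 + d / b) := by
    rw [← Real.log_mul (by positivity) (by positivity)]
    congr 1
    field_simp
  have h3 : d / b - 2 * (d / b) / (d / b + 2) = d ^ 2 / (b * (d + 2 * b)) := by
    field_simp
    ring
  have h4 : r / b - r / (b + d) = r * d / (b * (b + d)) := by
    field_simp
    ring
  have h5 : d ^ 2 / (b * (d + 2 * b)) ≤ r * d / (b * (b + d)) := by
    apply div_le_div₀ (mul_nonneg (hd.trans hdr) hd) (by nlinarith) (by positivity)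
    nlinarith
  linarith

theorem urn_ae_conv {Ω : Type*} {m0 : MeasurableSpace Ω} (μ : Measure Ω) [IsProbabilityMeasure μ]
    (ℱ : Filtration ℕ m0) (S Z : ℕ → Ω → ℝ) (hS : ∀ n, Measurable[ℱ n] (S n))
    (hb : ∀ n, ∃ K, ∀ ω, |S n ω| ≤ K) (hneg : ∀ n ω, S n ω ≤ 0)
    (hZ : ∀ n, Integrable (Z n) μ) (hinc : ∀ n ω, Z n ω ≤ S (n + 1) ω - S n ω)
    (hcond : ∀ n, μ[Z n | ℱ n] =ᵐ[μ] 0) :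
    ∀ᵐ ω ∂μ, ∃ c, Tendsto (fun n => S n ω) atTop (𝓝 c) := by
  have hint : ∀ n, Integrable (S n) μ := by
    intro n
    obtain ⟨K, hK⟩ := hb n
    exact Integrable.of_bound ((hS n).mono (ℱ.le n) le_rfl).aestronglyMeasurable K
      (Eventually.of_forall hK)
  have hsub : Submartingale S ℱ μ := by
    refine submartingale_of_condExp_sub_nonneg_nat (fun n => (hS n).stronglyMeasurable) hint ?_
    intro n
    have := condExp_mono (m := ℱ n) (hZ n) ((hint (n + 1)).sub (hint n))
      (Eventually.of_forall (hinc n))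
    exact (hcond n).symm.le.trans this
  have hmono : ∀ n, ∫ ω, S 0 ω ∂μ ≤ ∫ ω, S n ω ∂μ := by
    intro n
    have := hsub.setIntegral_le (Nat.zero_le n) (s := Set.univ) MeasurableSet.univ
    simpa using this
  refine hsub.exists_ae_tendsto_of_bdd (R := (-∫ ω, S 0 ω ∂μ).toNNReal) ?_
  intro n
  rw [eLpNorm_one_eq_lintegral_enorm, ← ofReal_integral_norm_eq_lintegral_enorm (hint n)]
  have : ∫ ω, ‖S n ω‖ ∂μ = - ∫ ω, S n ω ∂μ := by
    rw [← integral_neg]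
    congr 1
    ext ω
    rw [Real.norm_eq_abs, abs_of_nonpos (hneg n ω)]
  rw [this]
  apply ENNReal.ofReal_le_ofReal
  linarith [hmono n]

theorem urn_sum_swap {m : ℕ} {G : SimpleGraph (Fin m)} [DecidableRel G.Adj] {R : Type*}
    [AddCommMonoid R] (f : Fin m → Fin m → R) :
    ∑ i, ∑ j ∈ G.neighborFinset i, f i j = ∑ i, ∑ j ∈ G.neighborFinset i, f j i := by
  apply Finset.sum_comm'
  intro x y
  simp [G.adj_comm]

theorem urn_graph_rigid {m : ℕ} {G : SimpleGraph (Fin m)}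
    (hconn : G.Connected) (hnb : ¬ G.Colorable 2) (z : Fin m → ℝ)
    (hz : ∀ i j, G.Adj i j → z i + z j = 0) (i : Fin m) : z i = 0 := by
  by_contra hi
  have habs : ∀ j, |z j| = |z i| := by
    intro j
    obtain ⟨w⟩ := hconn.preconnected j i
    induction w with
    | nil => rfl
    | cons h p ih =>
      rw [← ih hi, eq_neg_of_add_eq_zero_left (hz _ _ h), abs_neg]
  apply hnb
  rw [SimpleGraph.colorable_iff_exists_bdd_nat_coloring]
  refine ⟨SimpleGraph.Coloring.mk (fun j => if 0 < z j then 1 else 0) ?_, ?_⟩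
  · intro u v huv
    have h1 := hz u v huv
    have hu : z u ≠ 0 := by
      intro h
      have := habs u
      rw [h, abs_zero] at this
      exact hi (abs_eq_zero.mp this.symm)
    rcases lt_or_gt_of_ne hu with h | h
    · have : 0 < z v := by linarith
      simp [this, not_lt.mpr h.le]
    · have : ¬ 0 < z v := by linarith
      simp [this, h]
  · intro v
    show (if 0 < z v then 1 else 0) < 2
    split_ifs <;> norm_num

/-- the drift term -/
noncomputable def urnH {m : ℕ} (G : SimpleGraph (Fin m)) [DecidableRel G.Adj]
    (N : ℝ) (b : Fin m → ℕ) : ℝ :=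
  (∑ i, ∑ j ∈ G.neighborFinset i, 1 / ((b i : ℝ) + b j)) - m * N / (∑ i, (b i : ℝ))

noncomputable def urnM {m : ℕ} (r : ℕ) (b : Fin m → ℕ) : ℝ :=
  (∑ i, (Real.log (b i) - r / (b i : ℝ))) - m * Real.log (∑ i, (b i : ℝ))

theorem urnH_eq {m r : ℕ} {G : SimpleGraph (Fin m)} [DecidableRel G.Adj]
    (hreg : G.IsRegularOfDegree r) (hm : 0 < m) (N : ℝ) (hN : 2 * N = m * r)
    (b : Fin m → ℕ) (hb : ∀ i, 1 ≤ b i) :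
    urnH G N b = ∑ i, ∑ j ∈ G.neighborFinset i,
      ((b i : ℝ) + b j - 2 * (∑ i, (b i : ℝ)) / m) ^ 2 /
        (((b i : ℝ) + b j) * (2 * (∑ i, (b i : ℝ)) / m) ^ 2) := by
  set T : ℝ := ∑ i, (b i : ℝ) with hT
  have hbR : ∀ i, (1 : ℝ) ≤ b i := fun i => by exact_mod_cast hb i
  have hTpos : 0 < T := by
    apply Finset.sum_pos
    · intro i _
      linarith [hbR i]
    · exact ⟨⟨0, hm⟩, Finset.mem_univ _⟩
  have hmR : (0 : ℝ) < m := by exact_mod_cast hm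
  have h1 : ∀ i j, ((b i : ℝ) + b j - 2 * T / m) ^ 2 / (((b i : ℝ) + b j) * (2 * T / m) ^ 2)
      = 1 / ((b i : ℝ) + b j) - m / T + (m ^ 2 / (4 * T ^ 2)) * ((b i : ℝ) + b j) := by
    intro i j
    have : (0 : ℝ) < (b i : ℝ) + b j := by linarith [hbR i, hbR j]
    field_simp
    ring
  have hdeg : ∀ i, (G.neighborFinset i).card = r := fun i => hreg i
  have h2 : ∑ i, ∑ j ∈ G.neighborFinset i, ((b i : ℝ) + b j) = 2 * r * T := by
    simp_rw [Finset.sum_add_distrib]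
    rw [← urn_sum_swap (fun i j => (b i : ℝ))]
    simp_rw [Finset.sum_const, hdeg, nsmul_eq_mul, ← Finset.mul_sum]
    ring
  have h3 : ∀ (A s : Fin m → Fin m → ℝ) (k q : ℝ),
      ∑ i, ∑ j ∈ G.neighborFinset i, (A i j - k + q * s i j) =
      ∑ i, ∑ j ∈ G.neighborFinset i, A i j - ∑ i, ∑ j ∈ G.neighborFinset i, k +
        q * ∑ i, ∑ j ∈ G.neighborFinset i, s i j := by
    intro A s k q
    simp_rw [Finset.sum_add_distrib, Finset.sum_sub_distrib, ← Finset.mul_sum]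
  simp_rw [h1]
  rw [h3, h2]
  simp_rw [Finset.sum_const, hdeg, nsmul_eq_mul]
  unfold urnH
  rw [← hT, Finset.sum_const, Finset.card_univ, Fintype.card_fin, nsmul_eq_mul]
  have : (r : ℝ) = 2 * N / m := by field_simp; linarith
  rw [this]
  field_simp
  ring

theorem urnH_nonneg {m r : ℕ} {G : SimpleGraph (Fin m)} [DecidableRel G.Adj]
    (hreg : G.IsRegularOfDegree r) (hm : 0 < m) (N : ℝ) (hN : 2 * N = m * r)
    (b : Fin m → ℕ) (hb : ∀ i, 1 ≤ b i) : 0 ≤ urnH G N b := by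
  rw [urnH_eq hreg hm N hN b hb]
  positivity

theorem urnM_nonpos {m : ℕ} (r : ℕ) (b : Fin m → ℕ) (hb : ∀ i, 1 ≤ b i) : urnM r b ≤ 0 := by
  have hbR : ∀ i, (1 : ℝ) ≤ b i := fun i => by exact_mod_cast hb i
  unfold urnM
  have : ∀ i ∈ Finset.univ, (Real.log (b i) - r / (b i : ℝ)) ≤ Real.log (∑ i, (b i : ℝ)) := by
    intro i hi
    have h1 : (0 : ℝ) ≤ r / (b i : ℝ) := by positivity
    have h2 : Real.log (b i) ≤ Real.log (∑ i, (b i : ℝ)) := by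
      apply Real.log_le_log (by linarith [hbR i])
      exact Finset.single_le_sum (f := fun i => (b i : ℝ)) (fun j _ => by positivity) hi
    linarith
  have := Finset.sum_le_card_nsmul _ _ _ this
  simp at this
  simpa using this

/-- deterministic part -/
theorem urn_det {m r : ℕ} {G : SimpleGraph (Fin m)} [DecidableRel G.Adj]
    (hreg : G.IsRegularOfDegree r) (hconn : G.Connected) (hnb : ¬ G.Colorable 2)
    (hm : 0 < m) (N : ℕ) (hN : 2 * (N : ℝ) = m * r) (hN0 : 0 < N)
    (b : ℕ → Fin m → ℕ) (hb : ∀ n i, 1 ≤ b n i) (N0 : ℕ)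
    (hT : ∀ n, ∑ i, b n i = N0 + n * N)
    (c c' : ℝ) (hM : Tendsto (fun n => urnM r (b n)) atTop (𝓝 c))
    (hA : Tendsto (fun n => ∑ k ∈ Finset.range n, urnH G N (b k)) atTop (𝓝 c')) (i : Fin m) :
    Tendsto (fun n => (b n i : ℝ) / ((N0 + n * N : ℕ) : ℝ)) atTop (𝓝 (1 / (m : ℝ))) := by
  have hmR : (0 : ℝ) < m := by exact_mod_cast hm
  set T : ℕ → ℝ := fun n => ((N0 + n * N : ℕ) : ℝ) with hTdef
  have hTR : ∀ n, ∑ i, (b n i : ℝ) = T n := by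
    intro n
    simp only [hTdef]
    rw [← hT n]
    push_cast
    rfl
  have hbR : ∀ n i, (1 : ℝ) ≤ b n i := fun n i => by exact_mod_cast hb n i
  have hbT : ∀ n i, (b n i : ℝ) ≤ T n := by
    intro n i
    rw [← hTR]
    exact Finset.single_le_sum (f := fun i => (b n i : ℝ)) (fun j _ => by positivity)
      (Finset.mem_univ i)
  have hTpos : ∀ n, 0 < T n := fun n => by linarith [hbT n i, hbR n i]
  have hTtop : Tendsto T atTop atTop := by
    apply tendsto_natCast_atTop_atTop.comp
    apply tendsto_atTop_mono (f := fun n : ℕ => n) _ tendsto_id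
    intro n
    nlinarith
  set x : ℕ → Fin m → ℝ := fun n i => (b n i : ℝ) / T n with hx
  have hxpos : ∀ n i, 0 < x n i := fun n i => div_pos (by linarith [hbR n i]) (hTpos n)
  have hx1 : ∀ n i, x n i ≤ 1 := fun n i => (div_le_one (hTpos n)).2 (hbT n i)
  have hxsum : ∀ n, ∑ i, x n i = 1 := by
    intro n
    rw [hx]
    simp only
    rw [← Finset.sum_div, hTR, div_self (hTpos n).ne']
  have hMx : ∀ n, urnM r (b n) = ∑ i, Real.log (x n i) - ∑ i, r / (b n i : ℝ) := by
    intro n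
    unfold urnM
    have : ∀ i, Real.log (x n i) = Real.log (b n i) - Real.log (T n) := fun i =>
      Real.log_div (by linarith [hbR n i]) (hTpos n).ne'
    simp_rw [this, Finset.sum_sub_distrib, hTR]
    simp
    ring
  obtain ⟨K, hK⟩ : ∃ K, ∀ n, K ≤ urnM r (b n) := by
    obtain ⟨K, hK⟩ := hM.bddBelow_range
    exact ⟨K, fun n => hK ⟨n, rfl⟩⟩
  have hlow : ∀ n i, Real.exp K ≤ x n i := by
    intro n i
    rw [← Real.le_log_iff_exp_le (hxpos n i)]
    have h1 := hK n
    rw [hMx] at h1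
    have h2 : 0 ≤ ∑ i, r / (b n i : ℝ) := by positivity
    have h3 : ∑ j, Real.log (x n j) ≤ Real.log (x n i) := by
      rw [← Finset.add_sum_erase _ _ (Finset.mem_univ i)]
      have : ∑ j ∈ Finset.univ.erase i, Real.log (x n j) ≤ 0 :=
        Finset.sum_nonpos (fun j _ => Real.log_nonpos (hxpos n j).le (hx1 n j))
      linarith
    linarith
  have hbtop : ∀ i, Tendsto (fun n => (b n i : ℝ)) atTop atTop := by
    intro i
    apply tendsto_atTop_mono (f := fun n => Real.exp K * T n)
    · intro n
      exact (le_div_iff₀ (hTpos n)).1 (hlow n i)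
    · exact hTtop.const_mul_atTop (Real.exp_pos K)
  have hlogc : Tendsto (fun n => ∑ i, Real.log (x n i)) atTop (𝓝 c) := by
    have h0 : Tendsto (fun n => ∑ i, r / (b n i : ℝ)) atTop (𝓝 (∑ i : Fin m, 0)) :=
      tendsto_finsetSum _ (fun i _ => (hbtop i).const_div_atTop _)
    have := hM.add h0
    simpa [hMx] using this
  have hHeq : ∀ n i j, G.Adj i j →
      (x n i + x n j - 2 / m) ^ 2 ≤ 8 * (T n * urnH G N (b n)) := by
    intro n i j hij
    have h1 : (((b n i : ℝ) + b n j - 2 * T n / m) ^ 2 /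
        (((b n i : ℝ) + b n j) * (2 * T n / m) ^ 2)) ≤ urnH G N (b n) := by
      rw [urnH_eq hreg hm N hN (b n) (hb n), hTR]
      refine le_trans ?_ (Finset.single_le_sum (f := fun i => ∑ j ∈ G.neighborFinset i,
        ((b n i : ℝ) + b n j - 2 * T n / m) ^ 2 / (((b n i : ℝ) + b n j) * (2 * T n / m) ^ 2))
        (fun _ _ => by positivity) (Finset.mem_univ i))
      exact Finset.single_le_sum (f := fun j =>
        ((b n i : ℝ) + b n j - 2 * T n / m) ^ 2 / (((b n i : ℝ) + b n j) * (2 * T n / m) ^ 2))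
        (fun _ _ => by positivity) (by simpa using hij)
    have hT0 := hTpos n
    have hbi : (b n i : ℝ) = T n * x n i := by
      simp only [hx]; field_simp
    have hbj : (b n j : ℝ) = T n * x n j := by
      simp only [hx]; field_simp
    have hxs : 0 < x n i + x n j := add_pos (hxpos n i) (hxpos n j)
    have h2 : T n * (((b n i : ℝ) + b n j - 2 * T n / m) ^ 2 /
        (((b n i : ℝ) + b n j) * (2 * T n / m) ^ 2)) =
        (x n i + x n j - 2 / m) ^ 2 * (m ^ 2 / 4 / (x n i + x n j)) := by
      rw [hbi, hbj]
      field_simp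
      ring
    have h3 : (1 : ℝ) / 8 ≤ m ^ 2 / 4 / (x n i + x n j) := by
      rw [le_div_iff₀ hxs]
      have : (1 : ℝ) ≤ m := by exact_mod_cast hm
      nlinarith [hx1 n i, hx1 n j]
    have h4 := mul_le_mul_of_nonneg_left h1 hT0.le
    rw [h2] at h4
    have h5 := mul_le_mul_of_nonneg_left h3 (sq_nonneg (x n i + x n j - 2 / m))
    linarith
  have hHnn : ∀ n, 0 ≤ urnH G N (b n) := fun n => urnH_nonneg hreg hm N hN (b n) (hb n)
  have hsum : Summable (fun n => urnH G N (b n)) :=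
    ((hasSum_iff_tendsto_nat_of_nonneg hHnn c').2 hA).summable
  have hfreq : ∀ k : ℕ, ∃ᶠ n in atTop, T n * urnH G N (b n) < 1 / ((k : ℝ) + 1) := by
    intro k hk
    rw [eventually_atTop] at hk
    obtain ⟨n0, hn0⟩ := hk
    have hk0 : (0 : ℝ) < (k : ℝ) + 1 := by positivity
    have hdiv : Summable (fun n : ℕ => 1 / ((n + (n0 + 1) : ℕ) : ℝ)) := by
      refine Summable.of_nonneg_of_le (fun n => by positivity) ?_
        (((summable_nat_add_iff (n0 + 1)).2 hsum).mul_left (((k : ℝ) + 1) * (N0 + N)))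
      intro n
      have h1 := not_lt.1 (hn0 (n + (n0 + 1)) (by omega))
      set q := n + (n0 + 1) with hq
      have hq1 : (1 : ℝ) ≤ q := by
        have : 1 ≤ q := by omega
        exact_mod_cast this
      have h2 : T q ≤ (N0 + N) * q := by
        simp only [hTdef]
        push_cast
        nlinarith [Nat.cast_nonneg (α := ℝ) N0]
      have h3 : 1 / ((k : ℝ) + 1) ≤ (N0 + N) * q * urnH G N (b q) :=
        h1.trans (mul_le_mul_of_nonneg_right h2 (hHnn q))
      rw [div_le_iff₀ hk0] at h3
      rw [div_le_iff₀ (by linarith)]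
      linarith
    have h := (summable_nat_add_iff (f := fun n : ℕ => 1 / (n : ℝ)) (n0 + 1)).1 hdiv
    exact Real.not_summable_one_div_natCast h
  obtain ⟨φ, hφ, hφ2⟩ := extraction_forall_of_frequently hfreq
  have hcomp : IsCompact (Set.Icc (0 : Fin m → ℝ) 1) := isCompact_Icc
  obtain ⟨y, -, ψ, hψ, hy⟩ := hcomp.tendsto_subseq (x := fun k => x (φ k))
    (fun k => ⟨fun i => (hxpos _ i).le, fun i => hx1 _ i⟩)
  rw [tendsto_pi_nhds] at hy
  have hyadj : ∀ i j, G.Adj i j → (y i - 1 / m) + (y j - 1 / m) = 0 := by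
    intro i j hij
    have h1 : Tendsto (fun k => (x (φ (ψ k)) i + x (φ (ψ k)) j - 2 / m) ^ 2) atTop
        (𝓝 ((y i + y j - 2 / m) ^ 2)) := (((hy i).add (hy j)).sub_const _).pow 2
    have h2 : Tendsto (fun k => (x (φ (ψ k)) i + x (φ (ψ k)) j - 2 / m) ^ 2) atTop (𝓝 0) := by
      have h3 : Tendsto (fun k => 8 * (1 / (((ψ k : ℕ) : ℝ) + 1))) atTop (𝓝 (8 * 0)) :=
        ((tendsto_one_div_add_atTop_nhds_zero_nat (𝕜 := ℝ)).comp hψ.tendsto_atTop).const_mul 8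
      rw [mul_zero] at h3
      refine squeeze_zero (fun k => sq_nonneg _) (fun k => ?_) h3
      refine (hHeq _ i j hij).trans ?_
      have := hφ2 (ψ k)
      linarith
    have := tendsto_nhds_unique h1 h2
    have := pow_eq_zero_iff (two_ne_zero) |>.1 this
    rw [← this]
    ring
  have hy1 : ∀ i, y i = 1 / m := fun i =>
    sub_eq_zero.1 (urn_graph_rigid hconn hnb (fun i => y i - 1 / m) hyadj i)
  have hc : c = m * Real.log (1 / m) := by
    have h1 : Tendsto (fun k => ∑ i, Real.log (x (φ (ψ k)) i)) atTop (𝓝 c) :=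
      hlogc.comp (hφ.tendsto_atTop.comp hψ.tendsto_atTop)
    have h2 : Tendsto (fun k => ∑ i, Real.log (x (φ (ψ k)) i)) atTop
        (𝓝 (∑ i, Real.log (y i))) := by
      apply tendsto_finsetSum
      intro i _
      refine (hy i).log ?_
      rw [hy1]
      positivity
    have := tendsto_nhds_unique h1 h2
    rw [this]
    simp [hy1]
  have hfin : Tendsto (fun n => (Real.sqrt (m * x n i) - 1) ^ 2) atTop (𝓝 0) := by
    have h1 : Tendsto (fun n => c - ∑ i, Real.log (x n i)) atTop (𝓝 0) := by
      simpa using hlogc.const_sub c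
    refine squeeze_zero (fun n => sq_nonneg _) (fun n => ?_) h1
    have hle : ∀ j, (Real.sqrt (m * x n j) - 1) ^ 2 ≤
        m * x n j - 1 - Real.log m - Real.log (x n j) := by
      intro j
      have hp : 0 < m * x n j := mul_pos hmR (hxpos n j)
      have h2 := Real.log_le_sub_one_of_pos (Real.sqrt_pos.2 hp)
      rw [Real.log_sqrt hp.le, Real.log_mul hmR.ne' (hxpos n j).ne'] at h2
      have h3 := Real.sq_sqrt hp.le
      nlinarith
    calc (Real.sqrt (m * x n i) - 1) ^ 2
        ≤ ∑ j, (Real.sqrt (m * x n j) - 1) ^ 2 :=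
          Finset.single_le_sum (f := fun j => (Real.sqrt (m * x n j) - 1) ^ 2)
            (fun _ _ => sq_nonneg _) (Finset.mem_univ i)
      _ ≤ ∑ j, (m * x n j - 1 - Real.log m - Real.log (x n j)) :=
          Finset.sum_le_sum (fun j _ => hle j)
      _ = c - ∑ i, Real.log (x n i) := by
          simp_rw [Finset.sum_sub_distrib, ← Finset.mul_sum, hxsum, hc]
          simp
  have h4 : Tendsto (fun n => Real.sqrt (m * x n i) - 1) atTop (𝓝 0) := by
    have := hfin.sqrt
    simp only [Real.sqrt_sq_eq_abs, Real.sqrt_zero] at this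
    exact (tendsto_zero_iff_abs_tendsto_zero _).2 this
  have h5 : Tendsto (fun n => (Real.sqrt (m * x n i) - 1 + 1) ^ 2 / m) atTop
      (𝓝 (((0 : ℝ) + 1) ^ 2 / (m : ℝ))) := ((h4.add_const 1).pow 2).div_const _
  have h6 : ∀ n, (Real.sqrt (m * x n i) - 1 + 1) ^ 2 / m = x n i := by
    intro n
    rw [sub_add_cancel, Real.sq_sqrt (mul_pos hmR (hxpos n i)).le]
    field_simp
  simp_rw [h6] at h5
  have h7 : ((0 : ℝ) + 1) ^ 2 / (m : ℝ) = 1 / m := by ring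
  rw [h7] at h5
  exact h5

theorem urn_meas_comp {m : ℕ} {Ω : Type*} (m1 : MeasurableSpace Ω) (F : (Fin m → ℕ) → ℝ)
    (B : Fin m → Ω → ℕ) (hB : ∀ i, Measurable (B i)) : Measurable (fun ω => F (fun i => B i ω)) :=
  (Measurable.of_discrete (f := F)).comp (measurable_pi_lambda _ hB)

theorem urn_tot_inc {m r : ℕ} {G : SimpleGraph (Fin m)} [DecidableRel G.Adj]
    (hreg : G.IsRegularOfDegree r) (N : ℕ) (hN : 2 * N = m * r)
    (d : Fin m → Fin m → ℕ) (hd : ∀ i j, G.Adj i j → d i j + d j i = 1) :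
    ∑ i, ∑ j ∈ G.neighborFinset i, d i j = N := by
  have h1 : ∑ i, ∑ j ∈ G.neighborFinset i, d i j + ∑ i, ∑ j ∈ G.neighborFinset i, d i j
      = m * r := by
    conv_lhs => rw [add_comm]
    nth_rewrite 2 [urn_sum_swap]
    simp_rw [← Finset.sum_add_distrib]
    have : ∀ i ∈ Finset.univ, ∑ j ∈ G.neighborFinset i, (d i j + d j i) = r := by
      intro i _
      rw [Finset.sum_congr rfl (fun j hj => hd i j (by simpa using hj))]
      simpa using hreg i
    rw [Finset.sum_congr rfl this]
    simp
  omega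

theorem urnM_inc {m r : ℕ} {G : SimpleGraph (Fin m)} [DecidableRel G.Adj]
    (hreg : G.IsRegularOfDegree r) (hm : 0 < m) (N : ℕ) (hN : 2 * N = m * r)
    (b b' : Fin m → ℕ) (hb : ∀ i, 1 ≤ b i)
    (d : Fin m → Fin m → ℕ) (hd : ∀ i j, G.Adj i j → d i j + d j i = 1)
    (hb' : ∀ i, b' i = b i + ∑ j ∈ G.neighborFinset i, d i j) :
    ∑ i, ∑ j ∈ G.neighborFinset i,
      (1 / (b i : ℝ)) * ((d i j : ℝ) - (b i : ℝ) / ((b i : ℝ) + b j)) + urnH G N b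
      ≤ urnM r b' - urnM r b := by
  have hbR : ∀ i, (1 : ℝ) ≤ b i := fun i => by exact_mod_cast hb i
  have hb'R : ∀ i, (b' i : ℝ) = b i + ∑ j ∈ G.neighborFinset i, (d i j : ℝ) := fun i => by
    rw [hb']
    push_cast
    rfl
  have hTpos : 0 < ∑ i, (b i : ℝ) := by
    apply Finset.sum_pos
    · intro i _
      linarith [hbR i]
    · exact ⟨⟨0, hm⟩, Finset.mem_univ _⟩
  have htot : ∑ i, (b' i : ℝ) = ∑ i, (b i : ℝ) + N := by
    simp_rw [hb'R, Finset.sum_add_distrib]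
    rw [← urn_tot_inc hreg N hN d hd]
    push_cast
    rfl
  have hdr : ∀ i, ∑ j ∈ G.neighborFinset i, (d i j : ℝ) ≤ r := by
    intro i
    have h1 : ∀ j ∈ G.neighborFinset i, (d i j : ℝ) ≤ 1 := by
      intro j hj
      have := hd i j (by simpa using hj)
      have : d i j ≤ 1 := by omega
      exact_mod_cast this
    have h2 := Finset.sum_le_card_nsmul _ _ _ h1
    have h3 : (G.neighborFinset i).card = r := hreg i
    rw [h3] at h2
    simpa using h2
  have hφ : ∀ i, (∑ j ∈ G.neighborFinset i, (d i j : ℝ)) / b i ≤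
      (Real.log (b' i) - r / (b' i : ℝ)) - (Real.log (b i) - r / (b i : ℝ)) := by
    intro i
    rw [hb'R]
    exact urn_phi_ineq _ _ _ (hbR i) (by positivity) (hdr i)
  have hlog : Real.log (∑ i, (b' i : ℝ)) - Real.log (∑ i, (b i : ℝ)) ≤
      N / ∑ i, (b i : ℝ) := by
    rw [htot, ← Real.log_div (by positivity) hTpos.ne']
    have := Real.log_le_sub_one_of_pos (x := (∑ i, (b i : ℝ) + N) / ∑ i, (b i : ℝ))
      (by positivity)
    refine this.trans (le_of_eq ?_)
    field_simp
    ring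
  have hZ : ∑ i, ∑ j ∈ G.neighborFinset i,
      (1 / (b i : ℝ)) * ((d i j : ℝ) - (b i : ℝ) / ((b i : ℝ) + b j)) =
      ∑ i, (∑ j ∈ G.neighborFinset i, (d i j : ℝ)) / b i -
      ∑ i, ∑ j ∈ G.neighborFinset i, 1 / ((b i : ℝ) + b j) := by
    simp_rw [Finset.sum_div]
    rw [← Finset.sum_sub_distrib]
    refine Finset.sum_congr rfl (fun i _ => ?_)
    rw [← Finset.sum_sub_distrib]
    refine Finset.sum_congr rfl (fun j _ => ?_)
    have h1 := hbR i
    have h2 := hbR j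
    have : (0 : ℝ) < (b i : ℝ) := by linarith
    have : (0 : ℝ) < (b i : ℝ) + b j := by linarith
    field_simp
  rw [hZ]
  have hs := Finset.sum_le_sum (s := Finset.univ) (fun i _ => hφ i)
  rw [Finset.sum_sub_distrib] at hs
  have hl := mul_le_mul_of_nonneg_left hlog (Nat.cast_nonneg (α := ℝ) m)
  rw [mul_sub, ← mul_div_assoc] at hl
  unfold urnM urnH
  linarith

theorem urn_unbundled {m r : ℕ} {G : SimpleGraph (Fin m)} [DecidableRel G.Adj]
    (hreg : G.IsRegularOfDegree r) (hconn : G.Connected) (hnb : ¬ G.Colorable 2)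
    (hm : 0 < m) (N : ℕ) (hN : 2 * N = m * r) (hN0 : 0 < N) (N0 : ℕ)
    {Ω : Type*} {m0 : MeasurableSpace Ω} (μ : Measure Ω) [IsProbabilityMeasure μ]
    (ℱ : Filtration ℕ m0) (B : ℕ → Fin m → Ω → ℕ) (δ : ℕ → Fin m → Fin m → Ω → ℕ)
    (B0_pos : ∀ i ω, 1 ≤ B 0 i ω) (B0_sum : ∀ ω, ∑ i, B 0 i ω = N0)
    (δ_sum : ∀ n i j, G.Adj i j → ∀ ω, δ n i j ω + δ n j i ω = 1)
    (B_succ : ∀ n i ω, B (n + 1) i ω = B n i ω + ∑ j ∈ G.neighborFinset i, δ (n + 1) i j ω)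
    (B_adapted : ∀ n i, Measurable[ℱ n] (B n i))
    (δ_adapted : ∀ n i j, Measurable[ℱ n] (δ n i j))
    (cond_law : ∀ n i j, G.Adj i j →
      μ[fun ω => (δ (n + 1) i j ω : ℝ) | ℱ n] =ᵐ[μ]
        fun ω => (B n i ω : ℝ) / ((B n i ω : ℝ) + (B n j ω : ℝ))) :
    ∀ᵐ ω ∂μ, ∀ i : Fin m, Tendsto (fun n => (B n i ω : ℝ) / ((N0 + n * N : ℕ) : ℝ))
      atTop (𝓝 (1 / (m : ℝ))) := by
  have hNR : 2 * (N : ℝ) = m * r := by exact_mod_cast hN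
  have hpos : ∀ n i ω, 1 ≤ B n i ω := by
    intro n i ω
    induction n with
    | zero => exact B0_pos i ω
    | succ n ih =>
      rw [B_succ]
      omega
  have hT : ∀ ω n, ∑ i, B n i ω = N0 + n * N := by
    intro ω n
    induction n with
    | zero => simp [B0_sum]
    | succ n ih =>
      simp_rw [B_succ, Finset.sum_add_distrib]
      rw [ih, urn_tot_inc hreg N hN (fun i j => δ (n + 1) i j ω)
        (fun i j hij => δ_sum (n + 1) i j hij ω)]
      ring
  have hmeas : ∀ (F : (Fin m → ℕ) → ℝ) (n : ℕ), Measurable[ℱ n] (fun ω => F (fun i => B n i ω)) := by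
    intro F n
    exact urn_meas_comp (ℱ n) F (B n) (B_adapted n)
  have hbdd : ∀ (F : (Fin m → ℕ) → ℝ) (n : ℕ), ∃ K, ∀ ω, |F (fun i => B n i ω)| ≤ K := by
    intro F n
    have hfin : (Set.Iic (fun _ : Fin m => N0 + n * N)).Finite := Set.finite_Iic _
    obtain ⟨K, hK⟩ := (hfin.image (fun b => |F b|)).bddAbove
    refine ⟨K, fun ω => hK ⟨_, ?_, rfl⟩⟩
    intro i
    show B n i ω ≤ N0 + n * N
    rw [← hT ω n]
    exact Finset.single_le_sum (f := fun i => B n i ω) (fun _ _ => Nat.zero_le _)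
      (Finset.mem_univ i)
  set M : ℕ → Ω → ℝ := fun n ω => urnM r (fun i => B n i ω) with hM
  set H : ℕ → Ω → ℝ := fun n ω => urnH G N (fun i => B n i ω) with hH
  set A : ℕ → Ω → ℝ := fun n ω => ∑ k ∈ Finset.range n, H k ω with hA
  set ζ : ℕ → Fin m → Fin m → Ω → ℝ := fun n i j ω =>
    (1 / (B n i ω : ℝ)) * ((δ (n + 1) i j ω : ℝ) - (B n i ω : ℝ) / ((B n i ω : ℝ) + B n j ω))
    with hζ
  set Z : ℕ → Ω → ℝ := fun n => ∑ i, ∑ j ∈ G.neighborFinset i, ζ n i j with hZ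
  have hHnn : ∀ n ω, 0 ≤ H n ω := fun n ω =>
    urnH_nonneg hreg hm N hNR _ (fun i => hpos n i ω)
  have hMnp : ∀ n ω, M n ω ≤ 0 := fun n ω => urnM_nonpos r _ (fun i => hpos n i ω)
  have hinc : ∀ n ω, Z n ω + H n ω ≤ M (n + 1) ω - M n ω := by
    intro n ω
    have := urnM_inc hreg hm N hN (fun i => B n i ω) (fun i => B (n + 1) i ω)
      (fun i => hpos n i ω) (fun i j => δ (n + 1) i j ω) (fun i j hij => δ_sum (n + 1) i j hij ω)
      (fun i => B_succ n i ω)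
    simpa [hZ, hζ, hH, hM] using this
  have hζδ : ∀ n i j, G.Adj i j → Integrable (fun ω => (δ (n + 1) i j ω : ℝ)) μ := by
    intro n i j hij
    refine Integrable.of_bound (C := 1) ?_ (Eventually.of_forall ?_)
    · have h1 : Measurable (δ (n + 1) i j) := (δ_adapted (n + 1) i j).mono (ℱ.le _) le_rfl
      exact (measurable_from_top.comp h1).aestronglyMeasurable
    · intro ω
      have := δ_sum (n + 1) i j hij ω
      have : δ (n + 1) i j ω ≤ 1 := by omega
      simpa using this
  have hpint : ∀ (F : (Fin m → ℕ) → ℝ) n, Integrable (fun ω => F (fun i => B n i ω)) μ := by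
    intro F n
    obtain ⟨K, hK⟩ := hbdd F n
    exact Integrable.of_bound ((hmeas F n).mono (ℱ.le n) le_rfl).aestronglyMeasurable K
      (Eventually.of_forall hK)
  have hζint : ∀ n i j, G.Adj i j → Integrable (ζ n i j) μ := by
    intro n i j hij
    obtain ⟨K, hK⟩ := hbdd (fun b => 1 / (b i : ℝ)) n
    refine Integrable.bdd_mul (c := K) ((hζδ n i j hij).sub
      (hpint (fun b => (b i : ℝ) / ((b i : ℝ) + b j)) n)) ?_ (Eventually.of_forall hK)
    exact ((hmeas (fun b => 1 / (b i : ℝ)) n).mono (ℱ.le n) le_rfl).aestronglyMeasurable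
  have hζcond : ∀ n i j, G.Adj i j → μ[ζ n i j | ℱ n] =ᵐ[μ] 0 := by
    intro n i j hij
    have hd := (hζδ n i j hij)
    have hp := hpint (fun b => (b i : ℝ) / ((b i : ℝ) + b j)) n
    have h1 := condExp_mul_of_stronglyMeasurable_left (m := ℱ n) (μ := μ)
      (f := fun ω => 1 / (B n i ω : ℝ))
      (g := (fun ω => (δ (n + 1) i j ω : ℝ)) -
        (fun ω => (B n i ω : ℝ) / ((B n i ω : ℝ) + B n j ω)))
      (hmeas (fun b => 1 / (b i : ℝ)) n).stronglyMeasurable (hζint n i j hij) (hd.sub hp)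
    have h2 := condExp_sub hd hp (ℱ n)
    have h3 := condExp_of_stronglyMeasurable (ℱ.le n)
      (hmeas (fun b => (b i : ℝ) / ((b i : ℝ) + b j)) n).stronglyMeasurable hp
    have h4 := cond_law n i j hij
    refine EventuallyEq.trans h1 ?_
    filter_upwards [h2, h4] with ω h2 h4
    have h5 := congrFun h3 ω
    simp only [Pi.mul_apply, Pi.zero_apply]
    rw [h2, Pi.sub_apply, h4, h5]
    simp
  have hZint : ∀ n, Integrable (Z n) μ := fun n =>
    integrable_finsetSum' _ (fun i _ => integrable_finsetSum' _
      (fun j hj => hζint n i j (by simpa using hj)))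
  have hZcond : ∀ n, μ[Z n | ℱ n] =ᵐ[μ] 0 := by
    intro n
    have h1 : ∀ i, μ[∑ j ∈ G.neighborFinset i, ζ n i j | ℱ n] =ᵐ[μ] 0 := by
      intro i
      refine (condExp_finsetSum (fun j hj => hζint n i j (by simpa using hj)) _).trans ?_
      have : ∀ᵐ ω ∂μ, ∀ j, G.Adj i j → (μ[ζ n i j | ℱ n]) ω = 0 := by
        rw [ae_all_iff]
        intro j
        by_cases hij : G.Adj i j
        · filter_upwards [hζcond n i j hij] with ω h _
          exact h
        · exact Eventually.of_forall (fun ω h => absurd h hij)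
      filter_upwards [this] with ω hω
      rw [Finset.sum_apply]
      exact Finset.sum_eq_zero (fun j hj => hω j (by simpa using hj))
    refine (condExp_finsetSum (fun i _ => integrable_finsetSum' _
      (fun j hj => hζint n i j (by simpa using hj))) _).trans ?_
    filter_upwards [ae_all_iff.2 h1] with ω hω
    rw [Finset.sum_apply]
    exact Finset.sum_eq_zero (fun i _ => hω i)
  have hAnn : ∀ n ω, 0 ≤ A n ω := fun n ω => Finset.sum_nonneg (fun k _ => hHnn k ω)
  have hAmeas : ∀ n, Measurable[ℱ n] (A n) := by
    intro n
    refine Finset.measurable_sum _ (fun k hk => ?_)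
    exact (hmeas (urnH G N) k).mono (ℱ.mono (Finset.mem_range.1 hk).le) le_rfl
  have hAbdd : ∀ n, ∃ K, ∀ ω, |A n ω| ≤ K := by
    intro n
    choose K hK using fun k => hbdd (urnH G N) k
    exact ⟨∑ k ∈ Finset.range n, K k, fun ω => (Finset.abs_sum_le_sum_abs _ _).trans
      (Finset.sum_le_sum (fun k _ => hK k ω))⟩
  have hconv1 := urn_ae_conv μ ℱ M Z (fun n => hmeas (urnM r) n) (fun n => hbdd (urnM r) n) hMnp
    hZint (fun n ω => by linarith [hinc n ω, hHnn n ω]) hZcond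
  have hconv2 := urn_ae_conv μ ℱ (fun n ω => M n ω - A n ω) Z
    (fun n => (hmeas (urnM r) n).sub (hAmeas n))
    (fun n => by
      obtain ⟨K1, h1⟩ := hbdd (urnM r) n
      obtain ⟨K2, h2⟩ := hAbdd n
      exact ⟨K1 + K2, fun ω => (abs_sub _ _).trans (add_le_add (h1 ω) (h2 ω))⟩)
    (fun n ω => by linarith [hMnp n ω, hAnn n ω]) hZint
    (fun n ω => by
      have h1 : A (n + 1) ω = A n ω + H n ω := Finset.sum_range_succ _ _
      have := hinc n ω
      linarith) hZcond
  filter_upwards [hconv1, hconv2] with ω h1 h2 i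
  obtain ⟨c, hc⟩ := h1
  obtain ⟨c', hc'⟩ := h2
  have h3 : Tendsto (fun n => A n ω) atTop (𝓝 (c - c')) := by
    have := hc.sub hc'
    simpa using this
  exact urn_det hreg hconn hnb hm N hNR hN0 (fun n i => B n i ω) (fun n i => hpos n i ω) N0
    (hT ω) c (c - c') hc h3 i

/-- **Theorem 1(a).** For a finite, regular, connected, non-bipartite graph `G` and `α = 1`,
the vector of proportions `x(n)` converges almost surely to the uniform measure
`(1/m, …, 1/m)`. -/
theorem polya_urn_regular_nonbipartite_converges_uniform
    {m r : ℕ} {G : SimpleGraph (Fin m)} [DecidableRel G.Adj]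
    (hreg : G.IsRegularOfDegree r) (hconn : G.Connected) (hnb : ¬ G.Colorable 2)
    (P : GraphUrn m G 1) :
    ∀ᵐ ω ∂P.μ, ∀ i : Fin m, Tendsto (fun n => P.x n ω i) atTop (𝓝 (1 / (m : ℝ))) := by
  have := P.isProb
  have hm : 0 < m := by
    obtain ⟨v⟩ := hconn.nonempty
    exact Nat.lt_of_le_of_lt (Nat.zero_le _) v.2
  have hN : 2 * G.edgeFinset.card = m * r := by
    rw [← G.sum_degrees_eq_twice_card_edges]
    simp [hreg.degree_eq]
  have hr : r ≠ 0 := by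
    rintro rfl
    apply hnb
    refine ⟨SimpleGraph.Coloring.mk (fun _ => 0) ?_⟩
    intro u v huv
    exfalso
    have h1 : (G.neighborFinset u).card = 0 := hreg u
    rw [Finset.card_eq_zero] at h1
    have h2 : v ∈ G.neighborFinset u := by simpa using huv
    rw [h1] at h2
    simp at h2
  have hN0 : 0 < G.edgeFinset.card := by
    have : 0 < m * r := Nat.mul_pos hm (Nat.pos_of_ne_zero hr)
    omega
  obtain ⟨ω0⟩ := P.μ.nonempty_of_neZero
  have hB0 : ∀ ω, ∑ j, P.B 0 j ω = ∑ j, P.B 0 j ω0 := fun ω =>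
    Finset.sum_congr rfl (fun j _ => P.B0_det j ω ω0)
  have hmain := urn_unbundled hreg hconn hnb hm G.edgeFinset.card hN hN0 (∑ j, P.B 0 j ω0)
    P.μ P.ℱ P.B P.δ P.B0_pos hB0 P.δ_sum P.B_succ P.B_adapted P.δ_adapted
    (fun n i j hij => by simpa only [Real.rpow_one] using P.cond_law n i j hij)
  filter_upwards [hmain] with ω hω i
  have := hω i
  unfold GraphUrn.x
  rw [hB0 ω]
  exact this
end

section
/- Let G be a finite connected graph and α > 0. Then almost surely the limit set of the sequence x(n) is a subset of Λ, the set of equilibria of the vector field F on Δ, where F_i(x) = -x_i + (1/N) Σ_{j ∼ i} x_i^α/(x_i^α + x_j^α). -/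
open MeasureTheory Filter Topology

open MeasureTheory Filter Topology

/-- The domain `Δ`: nonnegative vectors summing to `1` whose coordinates sum to at least `c`
on every edge of `G`. -/
def simplexDomain (m : ℕ) (G : SimpleGraph (Fin m)) (c : ℝ) : Set (Fin m → ℝ) :=
  {x | (∀ i, 0 ≤ x i) ∧ (∑ i, x i) = 1 ∧ ∀ i j, G.Adj i j → c ≤ x i + x j}

/-- The vector field `F` of the urn process:
`F_i(x) = -x_i + (1/N) ∑_{j ∼ i} x_i^α / (x_i^α + x_j^α)`. -/
noncomputable def urnField (m : ℕ) (G : SimpleGraph (Fin m)) [DecidableRel G.Adj] (α : ℝ)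
    (x : Fin m → ℝ) : Fin m → ℝ :=
  fun i => -x i + (1 / (G.edgeFinset.card : ℝ)) *
    ∑ j ∈ G.neighborFinset i, x i ^ α / (x i ^ α + x j ^ α)

/-- The equilibria set `Λ` of the vector field `F` on `Δ`. -/
def equilibria (m : ℕ) (G : SimpleGraph (Fin m)) [DecidableRel G.Adj] (α c : ℝ) :
    Set (Fin m → ℝ) :=
  {x ∈ simplexDomain m G c | urnField m G α x = 0}

namespace UrnProof

lemma log_sum_ineq {A B A' B' : ℝ} (hA : 0 < A) (hB : 0 < B) (hA' : 0 < A') (hB' : 0 < B') :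
    A / (A + B) * (Real.log A' - Real.log A) + B / (A + B) * (Real.log B' - Real.log B)
      ≤ Real.log (A' + B') - Real.log (A + B) := by
  have h1 : Real.log (A' / A / ((A' + B') / (A + B))) ≤ A' / A / ((A' + B') / (A + B)) - 1 :=
    Real.log_le_sub_one_of_pos (by positivity)
  have h2 : Real.log (B' / B / ((A' + B') / (A + B))) ≤ B' / B / ((A' + B') / (A + B)) - 1 :=
    Real.log_le_sub_one_of_pos (by positivity)
  rw [Real.log_div (by positivity) (by positivity), Real.log_div (by positivity) (by positivity),
    Real.log_div (by positivity) (by positivity)] at h1 h2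
  have e : A / (A + B) * (A' / A / ((A' + B') / (A + B)) - 1)
      + B / (A + B) * (B' / B / ((A' + B') / (A + B)) - 1) = 0 := by
    field_simp; ring
  have e2 : A / (A + B) + B / (A + B) = 1 := by field_simp
  have h1' := mul_le_mul_of_nonneg_left h1 (by positivity : 0 ≤ A / (A + B))
  have h2' := mul_le_mul_of_nonneg_left h2 (by positivity : 0 ≤ B / (A + B))
  have e3 : (A / (A + B) + B / (A + B)) * (Real.log (A' + B') - Real.log (A + B))
    = Real.log (A' + B') - Real.log (A + B) := by rw [e2, one_mul]
  linarith

lemma edge_ineq {α a b a' b' : ℝ} (hα : 0 < α) (ha : 0 < a) (hb : 0 < b) (ha' : 0 < a')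
    (hb' : 0 < b') :
    a ^ α / (a ^ α + b ^ α) * (Real.log a' - Real.log a)
      + b ^ α / (b ^ α + a ^ α) * (Real.log b' - Real.log b)
      ≤ 1 / α * (Real.log (a' ^ α + b' ^ α) - Real.log (a ^ α + b ^ α)) := by
  have h := log_sum_ineq (Real.rpow_pos_of_pos ha α) (Real.rpow_pos_of_pos hb α)
    (Real.rpow_pos_of_pos ha' α) (Real.rpow_pos_of_pos hb' α)
  rw [Real.log_rpow ha, Real.log_rpow hb, Real.log_rpow ha', Real.log_rpow hb'] at h
  rw [add_comm (b ^ α) (a ^ α)]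
  have h2 := mul_le_mul_of_nonneg_left h (by positivity : 0 ≤ 1 / α)
  refine le_trans (le_of_eq ?_) h2
  field_simp

lemma log_incr {b k N s : ℝ} (hb : 1 ≤ b) (hk : 0 ≤ k) (hkN : k ≤ N) (hs : 0 ≤ s) (hsN : s ≤ N) :
    s * k / b - N ^ 2 * (1 + N) * (1 / b - 1 / (b + k)) ≤
      s * (Real.log (b + k) - Real.log b) := by
  have hb0 : 0 < b := by linarith
  have h1 : k / (b + k) ≤ Real.log (b + k) - Real.log b := by
    rw [← Real.log_div (by positivity) (by positivity)]
    have := Real.one_sub_inv_le_log_of_pos (show 0 < (b + k) / b by positivity)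
    refine le_trans (le_of_eq ?_) this
    field_simp; ring
  refine le_trans ?_ (mul_le_mul_of_nonneg_left h1 hs)
  have e : s * k / b - s * (k / (b + k)) = s * k * (k / (b * (b + k))) := by field_simp; ring
  have e2 : 1 / b - 1 / (b + k) = k / (b * (b + k)) := by field_simp; ring
  rw [e2]
  have h3 : 0 ≤ k / (b * (b + k)) := by positivity
  have h4 : s * k ≤ N ^ 2 * (1 + N) := by
    have : s * k ≤ N * N := mul_le_mul hsN hkN hk (by linarith)
    nlinarith [pow_nonneg (by linarith : 0 ≤ N) 3]
  nlinarith [mul_le_mul_of_nonneg_right h4 h3]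

section graph
variable {m : ℕ} (G : SimpleGraph (Fin m)) [DecidableRel G.Adj]

lemma sum_symm (f : Fin m → Fin m → ℝ) :
    ∑ i, ∑ j ∈ G.neighborFinset i, f i j = ∑ i, ∑ j ∈ G.neighborFinset i, f j i := by
  rw [Finset.sum_comm' (t' := Finset.univ) (s' := fun j => G.neighborFinset j)]
  intro x y
  simp [G.adj_comm]

lemma sum_half (f : Fin m → Fin m → ℝ) (hf : ∀ i j, G.Adj i j → f i j + f j i = 1) :
    ∑ i, ∑ j ∈ G.neighborFinset i, f i j = G.edgeFinset.card := by
  have h1 := sum_symm G f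
  have h2 : ∑ i, ∑ j ∈ G.neighborFinset i, (f i j + f j i) = 2 * (G.edgeFinset.card : ℝ) := by
    have h3 : ∑ i, ∑ j ∈ G.neighborFinset i, (f i j + f j i)
        = ∑ i, ∑ j ∈ G.neighborFinset i, (1 : ℝ) := by
      refine Finset.sum_congr rfl fun i _ => Finset.sum_congr rfl fun j hj => hf i j ?_
      simpa using hj
    rw [h3]
    have := G.sum_degrees_eq_twice_card_edges
    simp only [Finset.sum_const, SimpleGraph.card_neighborFinset_eq_degree, nsmul_eq_mul, mul_one]
    exact_mod_cast this
  simp only [Finset.sum_add_distrib] at h2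
  linarith

/-- attraction of the neighbours -/
noncomputable def S (α : ℝ) (b : Fin m → ℝ) (i : Fin m) : ℝ :=
  ∑ j ∈ G.neighborFinset i, b i ^ α / (b i ^ α + b j ^ α)

/-- the Lyapunov function -/
noncomputable def V (α : ℝ) (b : Fin m → ℝ) : ℝ :=
  1 / 2 * ∑ i, ∑ j ∈ G.neighborFinset i, 1 / α * Real.log (b i ^ α + b j ^ α)
    - G.edgeFinset.card * Real.log (∑ i, b i)
    - ∑ i, (G.edgeFinset.card : ℝ) ^ 2 * (1 + G.edgeFinset.card) * (1 / b i)

lemma S_nonneg (α : ℝ) {b : Fin m → ℝ} (hb : ∀ i, 0 < b i) (i) : 0 ≤ S G α b i := by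
  refine Finset.sum_nonneg fun j _ => ?_
  have := Real.rpow_pos_of_pos (hb i) α
  have := Real.rpow_pos_of_pos (hb j) α
  positivity

lemma S_sum (α : ℝ) {b : Fin m → ℝ} (hb : ∀ i, 0 < b i) :
    ∑ i, S G α b i = G.edgeFinset.card := by
  apply sum_half G (fun i j => b i ^ α / (b i ^ α + b j ^ α))
  intro i j _
  have := Real.rpow_pos_of_pos (hb i) α
  have := Real.rpow_pos_of_pos (hb j) α
  rw [add_comm (b j ^ α)]
  field_simp

lemma S_le (α : ℝ) {b : Fin m → ℝ} (hb : ∀ i, 0 < b i) (i) : S G α b i ≤ G.edgeFinset.card := by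
  rw [← S_sum G α hb]
  exact Finset.single_le_sum (f := S G α b) (fun i _ => S_nonneg G α hb i) (Finset.mem_univ i)

lemma V_incr {α : ℝ} (hα : 0 < α) {b k : Fin m → ℝ} (hb : ∀ i, 1 ≤ b i) (hk : ∀ i, 0 ≤ k i)
    (hks : ∑ i, k i = G.edgeFinset.card) (hT : 0 < ∑ i, b i) :
    ∑ i, S G α b i * k i / b i - (G.edgeFinset.card : ℝ) ^ 2 / (∑ i, b i)
      ≤ V G α (fun i => b i + k i) - V G α b := by
  have hb0 : ∀ i, 0 < b i := fun i => by linarith [hb i]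
  have hbk : ∀ i, 0 < b i + k i := fun i => by linarith [hb i, hk i]
  set N : ℝ := (G.edgeFinset.card : ℝ) with hN
  have hN0 : 0 ≤ N := by positivity
  have hkN : ∀ i, k i ≤ N := fun i => by
    rw [← hks]; exact Finset.single_le_sum (f := k) (fun i _ => hk i) (Finset.mem_univ i)
  -- step 1
  have h1 : ∑ i, S G α b i * (Real.log (b i + k i) - Real.log (b i)) ≤
      1 / 2 * ∑ i, ∑ j ∈ G.neighborFinset i, 1 / α *
        (Real.log ((b i + k i) ^ α + (b j + k j) ^ α) - Real.log (b i ^ α + b j ^ α)) := by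
    set f : Fin m → Fin m → ℝ := fun i j =>
      b i ^ α / (b i ^ α + b j ^ α) * (Real.log (b i + k i) - Real.log (b i)) with hf
    have e1 : ∑ i, S G α b i * (Real.log (b i + k i) - Real.log (b i))
        = ∑ i, ∑ j ∈ G.neighborFinset i, f i j := by
      refine Finset.sum_congr rfl fun i _ => ?_
      rw [S, Finset.sum_mul]
    have e2 := sum_symm G f
    have h3 : ∑ i, ∑ j ∈ G.neighborFinset i, (f i j + f j i) ≤ ∑ i, ∑ j ∈ G.neighborFinset i,
        1 / α * (Real.log ((b i + k i) ^ α + (b j + k j) ^ α)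
          - Real.log (b i ^ α + b j ^ α)) :=
      Finset.sum_le_sum fun i _ => Finset.sum_le_sum fun j _ =>
        edge_ineq hα (hb0 i) (hb0 j) (hbk i) (hbk j)
    simp only [Finset.sum_add_distrib] at h3
    rw [e1]; linarith
  have h2 : ∑ i, (S G α b i * k i / b i - N ^ 2 * (1 + N) * (1 / b i - 1 / (b i + k i))) ≤
      ∑ i, S G α b i * (Real.log (b i + k i) - Real.log (b i)) :=
    Finset.sum_le_sum fun i _ => log_incr (hb i) (hk i) (hkN i) (S_nonneg G α hb0 i)
      (S_le G α hb0 i)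
  have h3 : N * (Real.log (∑ i, (b i + k i)) - Real.log (∑ i, b i)) ≤ N ^ 2 / ∑ i, b i := by
    rw [Finset.sum_add_distrib, hks, ← Real.log_div (by positivity) (by positivity)]
    have := Real.log_le_sub_one_of_pos (show 0 < ((∑ i, b i) + N) / ∑ i, b i by positivity)
    refine le_trans (mul_le_mul_of_nonneg_left this hN0) (le_of_eq ?_)
    field_simp; ring
  simp only [V, ← hN]
  simp only [mul_sub, Finset.sum_sub_distrib] at h1 h2 h3 ⊢
  linarith

lemma V_le {α : ℝ} (hα : 0 < α) {b : Fin m → ℝ} (hb : ∀ i, 1 ≤ b i) :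
    V G α b ≤ G.edgeFinset.card * (1 / α * Real.log 2) := by
  have hb0 : ∀ i, 0 < b i := fun i => by linarith [hb i]
  have hle : ∀ i, b i ≤ ∑ i, b i := fun i =>
    Finset.single_le_sum (f := b) (fun i _ => (hb0 i).le) (Finset.mem_univ i)
  have h1 : ∑ i, ∑ j ∈ G.neighborFinset i, 1 / α * Real.log (b i ^ α + b j ^ α) ≤
      ∑ i, ∑ j ∈ G.neighborFinset i, (1 / α * Real.log 2 + Real.log (∑ i, b i)) := by
    refine Finset.sum_le_sum fun i _ => Finset.sum_le_sum fun j _ => ?_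
    have hT : 0 < ∑ i, b i := lt_of_lt_of_le (hb0 i) (hle i)
    have hi := Real.rpow_le_rpow (hb0 i).le (hle i) hα.le
    have hj := Real.rpow_le_rpow (hb0 j).le (hle j) hα.le
    have := Real.rpow_pos_of_pos (hb0 i) α
    have := Real.rpow_pos_of_pos (hb0 j) α
    have h2 : Real.log (b i ^ α + b j ^ α) ≤ Real.log (2 * (∑ i, b i) ^ α) :=
      Real.log_le_log (by positivity) (by linarith)
    rw [Real.log_mul (by norm_num) (by positivity), Real.log_rpow hT] at h2
    refine le_trans (mul_le_mul_of_nonneg_left h2 (by positivity)) (le_of_eq ?_)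
    field_simp
  have h2 := sum_half G (fun _ _ => 1 / 2) (by intros; norm_num)
  have h3 : ∑ i, ∑ j ∈ G.neighborFinset i, (1 / α * Real.log 2 + Real.log (∑ i, b i))
      = 2 * (1 / α * Real.log 2 + Real.log (∑ i, b i)) *
        ∑ i, ∑ j ∈ G.neighborFinset i, (1 / 2 : ℝ) := by
    simp only [Finset.mul_sum]
    refine Finset.sum_congr rfl fun i _ => Finset.sum_congr rfl fun j _ => ?_
    ring
  rw [h3, h2] at h1
  have h4 : 0 ≤ ∑ i, (G.edgeFinset.card : ℝ) ^ 2 * (1 + G.edgeFinset.card) * (1 / b i) :=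
    Finset.sum_nonneg fun i _ => by have := hb0 i; positivity
  rw [V]
  nlinarith

/-- the dissipation -/
lemma D_eq {α : ℝ} {b : Fin m → ℝ} (hb : ∀ i, 0 < b i) (hT : 0 < ∑ i, b i) :
    ∑ i, S G α b i * S G α b i / b i - (G.edgeFinset.card : ℝ) ^ 2 / (∑ i, b i)
      = ∑ i, (S G α b i - G.edgeFinset.card * (b i / ∑ i, b i)) ^ 2 / b i := by
  set N : ℝ := (G.edgeFinset.card : ℝ) with hN
  set T := ∑ i, b i with hTd
  have e : ∀ i, (S G α b i - N * (b i / T)) ^ 2 / b i =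
      S G α b i * S G α b i / b i - 2 * N / T * S G α b i + N ^ 2 / T ^ 2 * b i := by
    intro i
    have := hb i
    field_simp; ring
  simp only [e, Finset.sum_add_distrib, Finset.sum_sub_distrib, ← Finset.mul_sum, S_sum G α hb,
    ← hTd, ← hN]
  field_simp; ring

lemma S_homog {α : ℝ} {b : Fin m → ℝ} (hb : ∀ i, 0 < b i) {T : ℝ} (hT : 0 < T) (i) :
    S G α (fun i => b i / T) i = S G α b i := by
  refine Finset.sum_congr rfl fun j _ => ?_
  have h1 := Real.rpow_pos_of_pos (hb i) α
  have h2 := Real.rpow_pos_of_pos (hb j) α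
  have h3 := Real.rpow_pos_of_pos hT α
  rw [Real.div_rpow (hb i).le hT.le, Real.div_rpow (hb j).le hT.le]
  field_simp

lemma field_sq_le {α : ℝ} {b : Fin m → ℝ} (hb : ∀ i, 0 < b i) (hT : 0 < ∑ i, b i)
    (hN : 0 < (G.edgeFinset.card : ℝ)) (i : Fin m) :
    1 / (∑ i, b i) * (urnField m G α (fun i => b i / ∑ i, b i) i) ^ 2 ≤
    1 / (G.edgeFinset.card : ℝ) ^ 2 *
     ∑ i, (S G α b i - G.edgeFinset.card * (b i / ∑ i, b i)) ^ 2 / b i := by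
  have h1 : (S G α b i - G.edgeFinset.card * (b i / ∑ i, b i)) ^ 2 / b i ≤
      ∑ i, (S G α b i - G.edgeFinset.card * (b i / ∑ i, b i)) ^ 2 / b i :=
    Finset.single_le_sum (f := fun i => (S G α b i - G.edgeFinset.card * (b i / ∑ i, b i)) ^ 2 / b i)
      (fun i _ => by have := hb i; positivity) (Finset.mem_univ i)
  refine le_trans ?_ (mul_le_mul_of_nonneg_left h1 (by positivity))
  have hu : urnField m G α (fun i => b i / ∑ i, b i) i
      = 1 / (G.edgeFinset.card : ℝ) * (S G α b i - G.edgeFinset.card * (b i / ∑ i, b i)) := by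
    rw [← S_homog G hb hT i, urnField, S]
    field_simp
    ring
  rw [hu]
  have hle : b i ≤ ∑ i, b i :=
    Finset.single_le_sum (f := b) (fun i _ => (hb i).le) (Finset.mem_univ i)
  set z := S G α b i - G.edgeFinset.card * (b i / ∑ i, b i)
  have : 1 / (∑ i, b i) ≤ 1 / b i := one_div_le_one_div_of_le (hb i) hle
  have h5 := mul_le_mul_of_nonneg_right this
    (by positivity : 0 ≤ (1 / (G.edgeFinset.card : ℝ) * z) ^ 2)
  refine le_trans h5 (le_of_eq ?_)
  ring

lemma field_continuousAt {α : ℝ} (hα : 0 < α) {v : Fin m → ℝ} (hv : ∀ i, 0 ≤ v i)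
    (hvc : ∀ i j, G.Adj i j → 0 < v i + v j) (i : Fin m) :
    ContinuousAt (fun y => urnField m G α y i) v := by
  unfold urnField
  have hc : ∀ i, ContinuousAt (fun y : Fin m → ℝ => y i ^ α) v := fun i =>
    (continuous_apply i).continuousAt.rpow_const (Or.inr hα.le)
  refine ((continuous_apply i).continuousAt.neg).add (continuousAt_const.mul ?_)
  refine tendsto_finsetSum _ fun j hj => ?_
  refine (hc i).div ((hc i).add (hc j)) ?_
  have hadj : G.Adj i j := by simpa using hj
  have h := hvc i j hadj
  have h1 := Real.rpow_nonneg (hv i) α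
  have h2 := Real.rpow_nonneg (hv j) α
  rcases (hv i).lt_or_eq with h3 | h3
  · have := Real.rpow_pos_of_pos h3 α
    positivity
  · have : 0 < v j := by linarith
    have := Real.rpow_pos_of_pos this α
    positivity

end graph

lemma cluster_zero {E : Type*} [PseudoMetricSpace E] {x : ℕ → E} {a : ℕ → ℝ} {K : ℝ} (hK : 0 < K)
    (ha : ∀ n, 0 ≤ a n) (hx : ∀ n, dist (x n) (x (n + 1)) ≤ K * a n)
    (hns : ¬ Summable a) {g : E → ℝ} (hg : ∀ y, 0 ≤ g y) {v : E} (hgv : ContinuousAt g v)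
    (hs : Summable fun n => a n * g (x n)) (hv : MapClusterPt v atTop x) : g v = 0 := by
  by_contra hne
  have hpos : 0 < g v := lt_of_le_of_ne (hg v) (Ne.symm hne)
  set ε := g v / 2 with hε
  have hε0 : 0 < ε := by positivity
  have hev : ∀ᶠ y in 𝓝 v, ε < g y := hgv.eventually (lt_mem_nhds (by linarith))
  obtain ⟨r, hr, hball⟩ := Metric.eventually_nhds_iff.1 hev
  set δ := r / (4 * K) with hδ
  have hδ0 : 0 < δ := by positivity
  have htail : ∀ᶠ p in atTop, ∑' k, a (k + p) * g (x (k + p)) < ε * δ :=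
    (tendsto_sum_nat_add fun n => a n * g (x n)).eventually (gt_mem_nhds (by positivity))
  have hfr : ∃ᶠ n in atTop, x n ∈ Metric.ball v (r / 2) :=
    hv.frequently (Metric.ball_mem_nhds v (by positivity))
  obtain ⟨p, hp1, hp2⟩ := (hfr.and_eventually htail).exists
  have hsp : Summable fun k => a (k + p) * g (x (k + p)) :=
    (summable_nat_add_iff p).2 hs
  have key : ∀ n, (∀ k < n, dist (x (k + p)) v < r) → ∑ k ∈ Finset.range n, a (k + p) ≤ δ := by
    intro n hn
    have h1 : ∑ k ∈ Finset.range n, a (k + p) * ε ≤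
        ∑ k ∈ Finset.range n, a (k + p) * g (x (k + p)) :=
      Finset.sum_le_sum fun k hk =>
        mul_le_mul_of_nonneg_left (hball (hn k (Finset.mem_range.1 hk))).le (ha _)
    have h2 := hsp.sum_le_tsum (Finset.range n) (fun k _ => mul_nonneg (ha _) (hg _))
    rw [← Finset.sum_mul] at h1
    have h3 : (∑ k ∈ Finset.range n, a (k + p)) * ε ≤ δ * ε := by linarith
    exact le_of_mul_le_mul_right h3 hε0
  have stay : ∀ n, dist (x (n + p)) v < r := by
    intro n
    induction n using Nat.strong_induction_on with
    | _ n ih =>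
      have h1 := key n ih
      have h2 : dist (x (0 + p)) (x (n + p)) ≤ ∑ k ∈ Finset.range n, K * a (k + p) := by
        refine dist_le_range_sum_of_dist_le (f := fun k => x (k + p)) n ?_
        intro k _
        have := hx (k + p)
        rwa [add_right_comm] at this
      rw [← Finset.mul_sum, zero_add] at h2
      have h3 : K * δ = r / 4 := by rw [hδ]; field_simp
      have h4 := mul_le_mul_of_nonneg_left h1 hK.le
      have h5 := dist_triangle_left (x (n + p)) v (x p)
      have h6 : dist (x p) v < r / 2 := hp1
      linarith
  apply hns
  rw [← summable_nat_add_iff p]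
  exact summable_of_sum_range_le (fun k => ha _) (fun n => key n fun k _ => stay k)

end UrnProof

namespace UrnProof

section prob
variable {m : ℕ} {G : SimpleGraph (Fin m)} [DecidableRel G.Adj] {α : ℝ}

instance urnMeasurableSpace (P : GraphUrn m G α) : MeasurableSpace P.Ω := P.mΩ

instance urnIsProb (P : GraphUrn m G α) : IsProbabilityMeasure P.μ := P.isProb

/-- real valued numbers of balls -/
def bb (P : GraphUrn m G α) (n : ℕ) (ω : P.Ω) (i : Fin m) : ℝ := P.B n i ω

/-- real valued increments -/
def kk (P : GraphUrn m G α) (n : ℕ) (ω : P.Ω) (i : Fin m) : ℝ :=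
  ∑ j ∈ G.neighborFinset i, (P.δ (n + 1) i j ω : ℝ)

lemma bb_succ (P : GraphUrn m G α) (n : ℕ) (ω : P.Ω) :
    bb P (n + 1) ω = fun i => bb P n ω i + kk P n ω i := by
  funext i
  simp [bb, kk, P.B_succ]

lemma kk_nonneg (P : GraphUrn m G α) (n : ℕ) (ω : P.Ω) (i) : 0 ≤ kk P n ω i :=
  Finset.sum_nonneg fun _ _ => by positivity

lemma bb_ge (P : GraphUrn m G α) (n : ℕ) (ω : P.Ω) (i) : 1 ≤ bb P n ω i := by
  induction n with
  | zero => unfold bb; exact_mod_cast P.B0_pos i ω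
  | succ n ih => rw [bb_succ]; have := kk_nonneg P n ω i; dsimp only; linarith

lemma bb_pos (P : GraphUrn m G α) (n : ℕ) (ω : P.Ω) (i) : 0 < bb P n ω i := by
  linarith [bb_ge P n ω i]

lemma kk_sum (P : GraphUrn m G α) (n : ℕ) (ω : P.Ω) :
    ∑ i, kk P n ω i = G.edgeFinset.card := by
  refine sum_half G (fun i j => (P.δ (n + 1) i j ω : ℝ)) fun i j h => ?_
  exact_mod_cast P.δ_sum (n + 1) i j h ω

lemma kk_le (P : GraphUrn m G α) (n : ℕ) (ω : P.Ω) (i) : kk P n ω i ≤ G.edgeFinset.card := by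
  rw [← kk_sum P n ω]
  exact Finset.single_le_sum (f := kk P n ω) (fun i _ => kk_nonneg P n ω i) (Finset.mem_univ i)

lemma bb_sum (P : GraphUrn m G α) (n : ℕ) (ω : P.Ω) :
    ∑ i, bb P n ω i = (((∑ j, P.B 0 j ω) + n * G.edgeFinset.card : ℕ) : ℝ) := by
  induction n with
  | zero => simp [bb]
  | succ n ih =>
    rw [bb_succ, Finset.sum_add_distrib, ih, kk_sum]
    push_cast; ring

lemma x_eq (P : GraphUrn m G α) (n : ℕ) (ω : P.Ω) :
    P.x n ω = fun i => bb P n ω i / ∑ i, bb P n ω i := by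
  funext i
  rw [bb_sum]; rfl

lemma edge_ge (P : GraphUrn m G α) (n : ℕ) (ω : P.Ω) (i j) (h : G.Adj i j) :
    (n : ℝ) ≤ bb P n ω i + bb P n ω j := by
  induction n with
  | zero => have := bb_pos P 0 ω i; have := bb_pos P 0 ω j; push_cast; linarith
  | succ n ih =>
    rw [bb_succ]
    have h1 : (P.δ (n + 1) i j ω : ℝ) ≤ kk P n ω i :=
      Finset.single_le_sum (f := fun j => (P.δ (n + 1) i j ω : ℝ)) (fun _ _ => by positivity)
        (by simpa using h)
    have h2 : (P.δ (n + 1) j i ω : ℝ) ≤ kk P n ω j :=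
      Finset.single_le_sum (f := fun i => (P.δ (n + 1) j i ω : ℝ)) (fun _ _ => by positivity)
        (by simpa using h.symm)
    have h3 : (P.δ (n + 1) i j ω : ℝ) + P.δ (n + 1) j i ω = 1 := by
      exact_mod_cast P.δ_sum (n + 1) i j h ω
    push_cast; linarith

lemma meas_fun (P : GraphUrn m G α) (n : ℕ) (φ : (Fin m → ℝ) → ℝ) :
    Measurable[P.ℱ n] (fun ω => φ (bb P n ω)) := by
  have h1 : Measurable[P.ℱ n] (fun ω => (fun i => P.B n i ω : Fin m → ℕ)) :=
    @measurable_pi_lambda _ _ _ (P.ℱ n) _ _ (fun i => P.B_adapted n i)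
  have h2 : Measurable (fun b : Fin m → ℕ => φ (fun i => (b i : ℝ))) := measurable_of_countable _
  exact h2.comp h1

lemma meas_δ (P : GraphUrn m G α) (n : ℕ) (i j) : Measurable (fun ω => (P.δ n i j ω : ℝ)) :=
  (measurable_of_countable (fun k : ℕ => (k : ℝ))).comp ((P.δ_adapted n i j).mono (P.ℱ.le n) le_rfl)

lemma δ_le (P : GraphUrn m G α) (n : ℕ) {i j} (h : G.Adj i j) (ω) : (P.δ n i j ω : ℝ) ≤ 1 := by
  have : P.δ n i j ω ≤ 1 := by have := P.δ_sum n i j h ω; omega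
  exact_mod_cast this

lemma int_bdd (P : GraphUrn m G α) {f : P.Ω → ℝ} (hf : Measurable f) (C : ℝ)
    (hC : ∀ ω, |f ω| ≤ C) : Integrable f P.μ :=
  Integrable.of_bound hf.aestronglyMeasurable C (Eventually.of_forall hC)

lemma Sb_bdd (P : GraphUrn m G α) (n : ℕ) (ω : P.Ω) (i) :
    0 ≤ S G α (bb P n ω) i / bb P n ω i ∧
      S G α (bb P n ω) i / bb P n ω i ≤ G.edgeFinset.card := by
  have h1 := S_nonneg G α (bb_pos P n ω) i
  have h2 := S_le G α (bb_pos P n ω) i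
  have h3 := bb_ge P n ω i
  have h4 := bb_pos P n ω i
  exact ⟨by positivity, (div_le_self h1 h3).trans h2⟩

lemma int_edge (P : GraphUrn m G α) (n : ℕ) {i j} (h : G.Adj i j) :
    Integrable (fun ω => S G α (bb P n ω) i / bb P n ω i * (P.δ (n + 1) i j ω : ℝ)) P.μ := by
  refine int_bdd P (((meas_fun P n (fun b => S G α b i / b i)).mono (P.ℱ.le n) le_rfl).mul
    (meas_δ P (n + 1) i j)) (G.edgeFinset.card * 1) fun ω => ?_
  have h1 := Sb_bdd P n ω i
  rw [abs_of_nonneg (mul_nonneg h1.1 (by positivity))]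
  exact mul_le_mul h1.2 (δ_le P _ h ω) (by positivity) (by positivity)

lemma p_bdd (P : GraphUrn m G α) (n : ℕ) (ω : P.Ω) (i j) :
    0 ≤ bb P n ω i ^ α / (bb P n ω i ^ α + bb P n ω j ^ α) ∧
    bb P n ω i ^ α / (bb P n ω i ^ α + bb P n ω j ^ α) ≤ 1 := by
  have h1 := Real.rpow_pos_of_pos (bb_pos P n ω i) α
  have h2 := Real.rpow_pos_of_pos (bb_pos P n ω j) α
  refine ⟨by positivity, ?_⟩
  rw [div_le_one (by positivity)]
  linarith

lemma int_edge' (P : GraphUrn m G α) (n : ℕ) (i j) :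
    Integrable (fun ω => S G α (bb P n ω) i / bb P n ω i *
      (bb P n ω i ^ α / (bb P n ω i ^ α + bb P n ω j ^ α))) P.μ := by
  refine int_bdd P ((meas_fun P n (fun b => S G α b i / b i *
    (b i ^ α / (b i ^ α + b j ^ α)))).mono (P.ℱ.le n) le_rfl)
    (G.edgeFinset.card * 1) fun ω => ?_
  have h1 := Sb_bdd P n ω i
  have h2 := p_bdd P n ω i j
  rw [abs_of_nonneg (mul_nonneg h1.1 h2.1)]
  exact mul_le_mul h1.2 h2.2 h2.1 (by positivity)

lemma integral_edge (P : GraphUrn m G α) (n : ℕ) {i j} (h : G.Adj i j) :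
    ∫ ω, S G α (bb P n ω) i / bb P n ω i * (P.δ (n + 1) i j ω : ℝ) ∂P.μ =
    ∫ ω, S G α (bb P n ω) i / bb P n ω i *
      (bb P n ω i ^ α / (bb P n ω i ^ α + bb P n ω j ^ α)) ∂P.μ := by
  have hδ : Integrable (fun ω => (P.δ (n + 1) i j ω : ℝ)) P.μ := by
    refine int_bdd P (meas_δ P (n + 1) i j) 1 fun ω => ?_
    rw [abs_of_nonneg (by positivity)]
    exact δ_le P _ h ω
  have h1 := condExp_mul_of_stronglyMeasurable_left (m := P.ℱ n) (μ := P.μ)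
    (meas_fun P n (fun b => S G α b i / b i)).stronglyMeasurable (int_edge P n h) hδ
  rw [← integral_condExp (P.ℱ.le n)]
  refine integral_congr_ae ?_
  filter_upwards [h1, P.cond_law n i j h] with ω h2 h3
  refine h2.trans ?_
  simp only [Pi.mul_apply, h3]
  rfl

/-- pathwise lower bound for the increment of the Lyapunov function -/
noncomputable def Z (P : GraphUrn m G α) (n : ℕ) (ω : P.Ω) : ℝ :=
  ∑ i, S G α (bb P n ω) i * kk P n ω i / bb P n ω i
    - (G.edgeFinset.card : ℝ) ^ 2 / (∑ i, bb P n ω i)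

/-- dissipation -/
noncomputable def D (P : GraphUrn m G α) (n : ℕ) (ω : P.Ω) : ℝ :=
  ∑ i, S G α (bb P n ω) i * S G α (bb P n ω) i / bb P n ω i
    - (G.edgeFinset.card : ℝ) ^ 2 / (∑ i, bb P n ω i)

lemma Z_eq (P : GraphUrn m G α) (n : ℕ) (ω : P.Ω) : Z P n ω =
    ∑ i, ∑ j ∈ G.neighborFinset i, S G α (bb P n ω) i / bb P n ω i * (P.δ (n + 1) i j ω : ℝ)
    - (G.edgeFinset.card : ℝ) ^ 2 / (∑ i, bb P n ω i) := by
  simp only [Z, kk, ← Finset.mul_sum, mul_div_right_comm]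

lemma D_eq' (P : GraphUrn m G α) (n : ℕ) (ω : P.Ω) : D P n ω =
    ∑ i, ∑ j ∈ G.neighborFinset i, S G α (bb P n ω) i / bb P n ω i *
      (bb P n ω i ^ α / (bb P n ω i ^ α + bb P n ω j ^ α))
    - (G.edgeFinset.card : ℝ) ^ 2 / (∑ i, bb P n ω i) := by
  simp only [D, ← Finset.mul_sum, mul_div_right_comm]
  rfl

lemma int_const (P : GraphUrn m G α) (n : ℕ) :
    Integrable (fun ω => (G.edgeFinset.card : ℝ) ^ 2 / (∑ i, bb P n ω i)) P.μ := by
  have hΩ : Nonempty P.Ω := nonempty_of_isProbabilityMeasure P.μ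
  obtain ⟨ω₀⟩ := hΩ
  have : (fun ω => (G.edgeFinset.card : ℝ) ^ 2 / (∑ i, bb P n ω i)) =
      fun _ => (G.edgeFinset.card : ℝ) ^ 2 / (∑ i, bb P n ω₀ i) := by
    funext ω
    rw [bb_sum, bb_sum]
    simp only [P.B0_det _ ω ω₀]
  rw [this]
  exact integrable_const _

lemma int_Z (P : GraphUrn m G α) (n : ℕ) : Integrable (Z P n) P.μ := by
  simp only [funext (Z_eq P n)]
  exact (integrable_finsetSum _ fun i _ => integrable_finsetSum _ fun j hj =>
    int_edge P n (by simpa using hj)).sub (int_const P n)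

lemma int_D (P : GraphUrn m G α) (n : ℕ) : Integrable (D P n) P.μ := by
  simp only [funext (D_eq' P n)]
  exact (integrable_finsetSum _ fun i _ => integrable_finsetSum _ fun j _ =>
    int_edge' P n i j).sub (int_const P n)

lemma integral_Z (P : GraphUrn m G α) (n : ℕ) : ∫ ω, Z P n ω ∂P.μ = ∫ ω, D P n ω ∂P.μ := by
  simp only [Z_eq, D_eq']
  have hj' : ∀ {i j}, j ∈ G.neighborFinset i → G.Adj i j := fun hj => by simpa using hj
  have hA : Integrable (fun ω => ∑ i, ∑ j ∈ G.neighborFinset i,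
      S G α (bb P n ω) i / bb P n ω i * (P.δ (n + 1) i j ω : ℝ)) P.μ :=
    integrable_finsetSum _ fun i _ => integrable_finsetSum _ fun j hj => int_edge P n (hj' hj)
  have hB : Integrable (fun ω => ∑ i, ∑ j ∈ G.neighborFinset i, S G α (bb P n ω) i / bb P n ω i *
      (bb P n ω i ^ α / (bb P n ω i ^ α + bb P n ω j ^ α))) P.μ :=
    integrable_finsetSum _ fun i _ => integrable_finsetSum _ fun j _ => int_edge' P n i j
  rw [integral_sub hA (int_const P n), integral_sub hB (int_const P n)]
  congr 1
  rw [integral_finsetSum _ fun i _ => integrable_finsetSum _ fun j hj =>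
      int_edge P n (hj' hj),
    integral_finsetSum _ fun i _ => integrable_finsetSum _ fun j _ => int_edge' P n i j]
  refine Finset.sum_congr rfl fun i _ => ?_
  rw [integral_finsetSum _ fun j hj => int_edge P n (hj' hj),
    integral_finsetSum _ fun j _ => int_edge' P n i j]
  exact Finset.sum_congr rfl fun j hj => integral_edge P n (hj' hj)

lemma T_pos (hm : Nonempty (Fin m)) (P : GraphUrn m G α) (n : ℕ) (ω : P.Ω) :
    0 < ∑ i, bb P n ω i :=
  Finset.sum_pos (fun i _ => bb_pos P n ω i) Finset.univ_nonempty

lemma sum_Z_le (hm : Nonempty (Fin m)) (hα : 0 < α) (P : GraphUrn m G α) (n : ℕ) (ω : P.Ω) :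
    ∑ k ∈ Finset.range n, Z P k ω ≤ G.edgeFinset.card * (1 / α * Real.log 2) - V G α (bb P 0 ω) := by
  have h1 : ∑ k ∈ Finset.range n, Z P k ω ≤
      ∑ k ∈ Finset.range n, (V G α (bb P (k + 1) ω) - V G α (bb P k ω)) := by
    refine Finset.sum_le_sum fun k _ => ?_
    rw [bb_succ]
    exact V_incr G hα (bb_ge P k ω) (kk_nonneg P k ω) (kk_sum P k ω) (T_pos hm P k ω)
  rw [Finset.sum_range_sub (fun k => V G α (bb P k ω))] at h1
  have := V_le G hα (bb_ge P n ω)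
  linarith

lemma D_nonneg (hm : Nonempty (Fin m)) (P : GraphUrn m G α) (n : ℕ) (ω : P.Ω) : 0 ≤ D P n ω := by
  rw [D, D_eq G (bb_pos P n ω) (T_pos hm P n ω)]
  exact Finset.sum_nonneg fun i _ => by have := bb_pos P n ω i; positivity

lemma summable_D (hm : Nonempty (Fin m)) (hα : 0 < α) (P : GraphUrn m G α) :
    ∀ᵐ ω ∂P.μ, Summable fun n => D P n ω := by
  obtain ⟨ω₀⟩ : Nonempty P.Ω := nonempty_of_isProbabilityMeasure P.μ
  set C := G.edgeFinset.card * (1 / α * Real.log 2) - V G α (bb P 0 ω₀) with hC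
  have h1 : ∀ n, ∑ k ∈ Finset.range n, ∫ ω, D P k ω ∂P.μ ≤ C := by
    intro n
    simp only [← integral_Z]
    rw [← integral_finsetSum _ fun k _ => int_Z P k]
    have : ∫ ω, ∑ k ∈ Finset.range n, Z P k ω ∂P.μ ≤ ∫ _, C ∂P.μ := by
      refine integral_mono (integrable_finsetSum _ fun k _ => int_Z P k) (integrable_const _) ?_
      intro ω
      have h2 := sum_Z_le hm hα P n ω
      have h3 : bb P 0 ω = bb P 0 ω₀ := by funext i; simp [bb, P.B0_det i ω ω₀]
      rw [h3] at h2
      exact h2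
    simpa using this
  have h2 : ∀ k, 0 ≤ ∫ ω, D P k ω ∂P.μ := fun k => integral_nonneg fun ω => D_nonneg hm P k ω
  have h3 : Summable fun k => ∫ ω, D P k ω ∂P.μ := summable_of_sum_range_le h2 h1
  have h4 : ∫⁻ ω, ∑' k, ENNReal.ofReal (D P k ω) ∂P.μ ≠ ⊤ := by
    rw [lintegral_tsum fun k => (int_D P k).aemeasurable.ennreal_ofReal]
    simp only [← ofReal_integral_eq_lintegral_ofReal (int_D P _)
      (Eventually.of_forall fun ω => D_nonneg hm P _ ω)]
    rw [← ENNReal.ofReal_tsum_of_nonneg h2 h3]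
    exact ENNReal.ofReal_ne_top
  have h5 := ae_lt_top' (AEMeasurable.tsum
    fun k => (int_D P k).aemeasurable.ennreal_ofReal) h4
  filter_upwards [h5] with ω h6
  have h7 := ENNReal.summable_toReal h6.ne
  simpa only [ENNReal.toReal_ofReal (D_nonneg hm P _ ω)] using h7

lemma x_step (hm : Nonempty (Fin m)) (P : GraphUrn m G α) (n : ℕ) (ω : P.Ω) :
    dist (P.x n ω) (P.x (n + 1) ω) ≤ 2 * G.edgeFinset.card * (1 / ∑ i, bb P n ω i) := by
  have hT := T_pos hm P n ω
  have hN : (0 : ℝ) ≤ G.edgeFinset.card := by positivity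
  rw [dist_pi_le_iff (by positivity)]
  intro i
  rw [x_eq, x_eq, bb_succ, Finset.sum_add_distrib, kk_sum, Real.dist_eq]
  have hle : bb P n ω i ≤ ∑ i, bb P n ω i :=
    Finset.single_le_sum (f := bb P n ω) (fun i _ => (bb_pos P n ω i).le) (Finset.mem_univ i)
  have hb := bb_pos P n ω i
  have hk0 := kk_nonneg P n ω i
  have hk := kk_le P n ω i
  dsimp only
  set T := ∑ i, bb P n ω i
  set N : ℝ := (G.edgeFinset.card : ℝ)
  set b := bb P n ω i
  set k := kk P n ω i
  have e : b / T - (b + k) / (T + N) = (b * N / T - k) / (T + N) := by field_simp; ring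
  have h1 : b * N / T ≤ N := by rw [div_le_iff₀ hT]; nlinarith
  have h2 : 0 ≤ b * N / T := by positivity
  rw [e, abs_div, abs_of_pos (by positivity : 0 < T + N), mul_one_div]
  have h3 : |b * N / T - k| ≤ 2 * N := abs_le.2 ⟨by linarith, by linarith⟩
  exact div_le_div₀ (by positivity) h3 hT (by linarith)

lemma not_summable_T (hN : 0 < (G.edgeFinset.card : ℝ)) (hm : Nonempty (Fin m))
    (P : GraphUrn m G α) (ω : P.Ω) : ¬ Summable fun n => 1 / ∑ i, bb P n ω i := by
  intro h
  obtain ⟨T0, hT0d⟩ : ∃ T0, T0 = ∑ i, bb P 0 ω i := ⟨_, rfl⟩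
  have hT0 : 0 < T0 := hT0d ▸ T_pos hm P 0 ω
  have hT : ∀ n, ∑ i, bb P n ω i = T0 + n * G.edgeFinset.card := by
    intro n
    rw [hT0d, bb_sum, bb_sum]; push_cast; ring
  have h2 := (summable_nat_add_iff 1).2 (h.mul_left (T0 + G.edgeFinset.card))
  refine ((summable_nat_add_iff 1).not.2 Real.not_summable_one_div_natCast) (h2.of_nonneg_of_le ?_ ?_)
  · intro n; positivity
  · intro n
    rw [hT, mul_one_div]
    have hA : (0 : ℝ) < ((n + 1 : ℕ) : ℝ) := Nat.cast_pos.2 n.succ_pos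
    have hB : 0 < T0 + ((n + 1 : ℕ) : ℝ) * (G.edgeFinset.card : ℝ) :=
      add_pos hT0 (mul_pos hA hN)
    rw [div_le_div_iff₀ hA hB]
    push_cast
    nlinarith [mul_nonneg (Nat.cast_nonneg (α := ℝ) n) hT0.le]

end prob

end UrnProof

/-- **Theorem 2.** For a finite connected graph `G` and any `α > 0`, almost surely the limit
set of the sequence `x(n)` is contained in the equilibria set `Λ` of the vector field `F`
on `Δ`. -/
theorem polya_urn_limit_set_subset_equilibria
    {m : ℕ} {G : SimpleGraph (Fin m)} [DecidableRel G.Adj] {α c : ℝ}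
    (hconn : G.Connected) (hα : 0 < α)
    (hc : 0 < c) (hcN : c < 1 / (G.edgeFinset.card : ℝ))
    (P : GraphUrn m G α) :
    ∀ᵐ ω ∂P.μ, ∀ v : Fin m → ℝ, MapClusterPt v atTop (fun n => P.x n ω) →
      v ∈ equilibria m G α c := by
  have hN : 0 < (G.edgeFinset.card : ℝ) := by
    rcases (Nat.cast_nonneg (α := ℝ) G.edgeFinset.card).lt_or_eq with h | h
    · exact h
    · rw [← h] at hcN; norm_num at hcN; linarith
  have hm : Nonempty (Fin m) := hconn.nonempty
  filter_upwards [UrnProof.summable_D hm hα P] with ω hω v hv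
  have hΔ : v ∈ simplexDomain m G c := by
    refine ⟨fun i => ?_, ?_, fun i j hij => ?_⟩
    · refine (isClosed_le continuous_const (continuous_apply i)).mem_of_mapClusterPt
        (s := {y : Fin m → ℝ | 0 ≤ y i}) hv (Eventually.of_forall fun n => ?_)
      rw [Set.mem_ofPred_eq, UrnProof.x_eq]
      exact div_nonneg (UrnProof.bb_pos P n ω i).le (UrnProof.T_pos hm P n ω).le
    · refine (isClosed_eq (continuous_finsetSum _ fun i _ => continuous_apply i)
        continuous_const).mem_of_mapClusterPt
        (s := {y : Fin m → ℝ | ∑ i, y i = 1}) hv (Eventually.of_forall fun n => ?_)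
      rw [Set.mem_ofPred_eq, UrnProof.x_eq]
      rw [← Finset.sum_div, div_self (UrnProof.T_pos hm P n ω).ne']
    · refine (isClosed_le continuous_const ((continuous_apply i).add
        (continuous_apply j))).mem_of_mapClusterPt
        (s := {y : Fin m → ℝ | c ≤ y i + y j}) hv ?_
      have hcN' : 0 < 1 - c * (G.edgeFinset.card : ℝ) := by
        rw [lt_div_iff₀ hN] at hcN; linarith
      have h1 := tendsto_natCast_atTop_atTop (R := ℝ).eventually_ge_atTop
        (c * ((∑ j, P.B 0 j ω : ℕ) : ℝ) / (1 - c * (G.edgeFinset.card : ℝ)))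
      filter_upwards [h1] with n hn
      rw [UrnProof.x_eq]
      have h2 := UrnProof.edge_ge P n ω i j hij
      have h3 := UrnProof.T_pos hm P n ω
      rw [← add_div, le_div_iff₀ h3, UrnProof.bb_sum]
      rw [div_le_iff₀ hcN'] at hn
      push_cast at hn ⊢
      nlinarith
  refine ⟨hΔ, ?_⟩
  funext i
  have hz := UrnProof.cluster_zero (x := fun n => P.x n ω)
    (a := fun n => 1 / ∑ i, UrnProof.bb P n ω i) (K := 2 * G.edgeFinset.card)
    (by positivity) (fun n => by have := UrnProof.T_pos hm P n ω; positivity)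
    (fun n => UrnProof.x_step hm P n ω) (UrnProof.not_summable_T hN hm P ω)
    (g := fun y => (urnField m G α y i) ^ 2) (fun y => sq_nonneg _)
    ((UrnProof.field_continuousAt G hα hΔ.1 (fun i j h => hc.trans_le (hΔ.2.2 i j h)) i).pow 2)
    (Summable.of_nonneg_of_le
      (fun n => by have := UrnProof.T_pos hm P n ω; positivity)
      (fun n => by
        have h := UrnProof.field_sq_le (α := α) G (UrnProof.bb_pos P n ω)
          (UrnProof.T_pos hm P n ω) hN i
        rw [← UrnProof.D_eq G (UrnProof.bb_pos P n ω) (UrnProof.T_pos hm P n ω)] at h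
        rw [UrnProof.x_eq]
        exact h)
      (hω.mul_left (1 / (G.edgeFinset.card : ℝ) ^ 2))) hv
  simpa using hz
end

section
/- Let G be a finite, connected graph that is not balanced bipartite (i.e., it admits no bipartition V = A ∪ B with #A = #B), and let α = 1. Then the equilibria set Λ is finite, and almost surely x(n) converges to an element of Λ. -/
open MeasureTheory Filter Topology

open MeasureTheory Filter Topology

section Analytic

/-- A sequence with vanishing steps, eventually in a compact set, along which a continuous function
with finitely many zeros tends to zero, converges to one of the zeros. -/
lemma conv_of_finite_zeros {E : Type*} [MetricSpace E] {K Z : Set E} (hK : IsCompact K)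
    {D : E → ℝ} (hD : ContinuousOn D K) (hD0 : ∀ y ∈ K, 0 ≤ D y)
    (hZ : ∀ y ∈ K, D y = 0 → y ∈ Z) (hfin : Z.Finite)
    {x : ℕ → E} (hx : ∀ᶠ n in atTop, x n ∈ K)
    (hstep : Tendsto (fun n => dist (x (n + 1)) (x n)) atTop (𝓝 0))
    (hDx : Tendsto (fun n => D (x n)) atTop (𝓝 0)) :
    ∃ v ∈ Z, Tendsto x atTop (𝓝 v) := by
  -- positivity on zero-free compact subsets
  have key : ∀ C : Set E, IsClosed C → (∀ y ∈ C, y ∉ Z) → ∀ᶠ n in atTop, x n ∉ C := by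
    intro C hC hCZ
    have hKC : IsCompact (K ∩ C) := hK.inter_right hC
    rcases (K ∩ C).eq_empty_or_nonempty with he | hne
    · filter_upwards [hx] with n hn hnC
      have : x n ∈ K ∩ C := ⟨hn, hnC⟩
      simp [he] at this
    · obtain ⟨y, hy, hmin⟩ := hKC.exists_isMinOn hne (hD.mono Set.inter_subset_left)
      have hpos : 0 < D y := by
        rcases (hD0 y hy.1).lt_or_eq with h | h
        · exact h
        · exact absurd (hZ y hy.1 h.symm) (hCZ y hy.2)
      filter_upwards [hx, hDx.eventually (gt_mem_nhds hpos)] with n hn hlt hnC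
      have := hmin (show x n ∈ K ∩ C from ⟨hn, hnC⟩)
      simp only [Set.mem_ofPred_eq] at this
      linarith
  obtain ⟨v, hvK, hv⟩ := hK.exists_mapClusterPt_of_frequently hx.frequently
  have hfreq : ∀ ε > 0, ∃ᶠ n in atTop, dist (x n) v < ε := by
    intro ε hε
    exact hv.frequently (Metric.ball_mem_nhds v hε)
  have hvZ : v ∈ Z := by
    by_contra hvZ
    have hop : Zᶜ ∈ 𝓝 v := hfin.isClosed.isOpen_compl.mem_nhds hvZ
    obtain ⟨r, hr, hball⟩ := Metric.nhds_basis_closedBall.mem_iff.1 hop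
    have h1 := key (Metric.closedBall v r) Metric.isClosed_closedBall (fun y hy => hball hy)
    obtain ⟨n, h2, h3⟩ := ((hfreq r hr).and_eventually h1).exists
    exact h3 (Metric.mem_closedBall.2 h2.le)
  refine ⟨v, hvZ, ?_⟩
  have hop : (Z \ {v})ᶜ ∈ 𝓝 v := (hfin.subset Set.sdiff_subset).isClosed.isOpen_compl.mem_nhds
    (by simp)
  obtain ⟨r, hr, hball⟩ := Metric.nhds_basis_closedBall.mem_iff.1 hop
  rw [Metric.tendsto_atTop]
  intro ε₀ hε₀
  obtain ⟨ε, hε, hεr, hεε⟩ : ∃ ε > 0, ε ≤ r ∧ ε ≤ ε₀ :=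
    ⟨min r ε₀, lt_min hr hε₀, min_le_left _ _, min_le_right _ _⟩
  have hC : IsClosed ({y : E | ε / 2 ≤ dist y v} ∩ Metric.closedBall v ε) :=
    (isClosed_le continuous_const (continuous_id.dist continuous_const)).inter
      Metric.isClosed_closedBall
  have h1 := key _ hC (by
    rintro y ⟨hy1, hy2⟩ hyZ
    have := hball (Metric.mem_closedBall.2 ((Metric.mem_closedBall.1 hy2).trans hεr))
    apply this
    refine ⟨hyZ, ?_⟩
    rintro rfl
    simp at hy1
    linarith)
  have h2 := hstep.eventually (gt_mem_nhds (half_pos hε))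
  obtain ⟨n0, hn0⟩ := eventually_atTop.1 (h1.and h2)
  obtain ⟨n1, hn1, hlt⟩ := (frequently_atTop.1 (hfreq (ε / 2) (half_pos hε))) n0
  refine ⟨n1, fun n hn => ?_⟩
  have : dist (x n) v < ε / 2 := by
    induction n, hn using Nat.le_induction with
    | base => exact hlt
    | succ n hn ih =>
      have ha := (hn0 n (hn1.trans hn)).2
      have hb := (hn0 (n + 1) (by omega)).1
      have hc := dist_triangle (x (n + 1)) (x n) v
      by_contra hcon
      exact hb ⟨not_lt.1 hcon, Metric.mem_closedBall.2 (by linarith)⟩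
  linarith

/-- Summability against the harmonic weights plus slow variation forces convergence to zero. -/
lemma tendsto_zero_of_summable {E : Type*} [MetricSpace E] {K : Set E} (hK : IsCompact K)
    {D : E → ℝ} (hD : ContinuousOn D K) (hD0 : ∀ y ∈ K, 0 ≤ D y)
    {x : ℕ → E} (hx : ∀ n, x n ∈ K)
    (hstep : ∀ n, dist (x (n + 1)) (x n) ≤ 1 / ((n : ℝ) + 1))
    (hsum : Summable (fun n => D (x n) / ((n : ℝ) + 1))) :
    Tendsto (fun n => D (x n)) atTop (𝓝 0) := by
  have huc := hK.uniformContinuousOn_of_continuous hD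
  rw [Metric.uniformContinuousOn_iff] at huc
  rw [Metric.tendsto_atTop]
  intro ε hε
  obtain ⟨η, hη, hcont⟩ := huc (ε / 2) (half_pos hε)
  -- a natural number with 1/q < η
  obtain ⟨q, hq0, hq⟩ : ∃ q : ℕ, 0 < q ∧ 1 / (q : ℝ) < η := by
    obtain ⟨q, hq⟩ := exists_nat_one_div_lt hη
    exact ⟨q + 1, by omega, by push_cast; exact hq⟩
  have hqR : (0 : ℝ) < q := by exact_mod_cast hq0
  -- distances
  have hdist : ∀ n k : ℕ, dist (x (n + k)) (x n) ≤ k / ((n : ℝ) + 1) := by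
    intro n k
    induction k with
    | zero => simp
    | succ k ih =>
      have h1 := dist_triangle (x (n + (k + 1))) (x (n + k)) (x n)
      have h2 := hstep (n + k)
      have h3 : 1 / (((n + k : ℕ) : ℝ) + 1) ≤ 1 / ((n : ℝ) + 1) := by
        apply one_div_le_one_div_of_le (by positivity)
        push_cast
        linarith [(Nat.cast_nonneg k : (0 : ℝ) ≤ k)]
      rw [← add_assoc] at h1 ⊢
      push_cast
      rw [add_div]
      linarith
  set f : ℕ → ℝ := fun n => D (x n) / ((n : ℝ) + 1) with hf
  have hf0 : ∀ n, 0 ≤ f n := fun n => div_nonneg (hD0 _ (hx n)) (by positivity)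
  -- tail
  have htail := tendsto_sum_nat_add f
  have hδ : 0 < ε / (8 * q) := by positivity
  obtain ⟨n0, hn0⟩ := eventually_atTop.1 (htail.eventually (gt_mem_nhds hδ))
  refine ⟨n0 + q, fun n hn => ?_⟩
  rw [Real.dist_eq, sub_zero, abs_of_nonneg (hD0 _ (hx n))]
  by_contra hcon
  push Not at hcon
  have hnq : q ≤ n := by omega
  have hkq : 1 ≤ n / q := (Nat.one_le_div_iff hq0).2 hnq
  set k := n / q with hk
  have hkR : (k : ℝ) * q ≤ n := by exact_mod_cast Nat.div_mul_le_self n q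
  have hkR2 : (n : ℝ) ≤ 2 * k * q := by
    have h1 : n < k * q + q := by
      have := Nat.lt_div_mul_add (a := n) hq0
      exact this
    have h2 : q ≤ k * q := Nat.le_mul_of_pos_left q hkq
    have : n ≤ 2 * k * q := by nlinarith
    exact_mod_cast this
  have hkle : (k : ℝ) ≤ n := by exact_mod_cast Nat.div_le_self n q
  have hk1 : (1 : ℝ) ≤ k := by exact_mod_cast hkq
  have hbig : ∀ j ∈ Finset.range k, ε / 2 / (2 * n) ≤ f (j + n) := by
    intro j hj
    have hj' : j < k := Finset.mem_range.1 hj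
    have hjR : (j : ℝ) + 1 ≤ k := by exact_mod_cast hj'
    have hd : dist (x n) (x (n + j)) < η := by
      rw [dist_comm]
      refine (hdist n j).trans_lt (lt_of_le_of_lt ?_ hq)
      rw [div_le_div_iff₀ (by positivity) hqR]
      nlinarith
    have h1 := hcont _ (hx n) _ (hx (n + j)) hd
    rw [Real.dist_eq] at h1
    have h2 := (abs_lt.1 h1).2
    have h3 : ε / 2 ≤ D (x (j + n)) := by rw [add_comm]; linarith
    simp only [hf]
    apply div_le_div₀ (by linarith) h3 (by positivity)
    push_cast
    linarith
  have hs := (Finset.sum_le_sum hbig).trans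
    (Summable.sum_le_tsum (Finset.range k) (fun j _ => hf0 (j + n))
      ((summable_nat_add_iff n).2 hsum))
  have hlast := hn0 n (by omega)
  rw [Finset.sum_const, Finset.card_range, nsmul_eq_mul] at hs
  have hnpos : (0 : ℝ) < n := by linarith
  have : ε / (8 * q) ≤ k * (ε / 2 / (2 * n)) := by
    rw [div_div, mul_div_assoc', div_le_div_iff₀ (by positivity) (by positivity)]
    nlinarith
  linarith

end Analytic

section Deterministic

variable {m : ℕ} (G : SimpleGraph (Fin m)) [DecidableRel G.Adj]

/-- `h_i(x) = ∑_{j ∼ i} 1 / (x_i + x_j)`. -/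
noncomputable def nbrInv (x : Fin m → ℝ) (i : Fin m) : ℝ :=
  ∑ j ∈ G.neighborFinset i, 1 / (x i + x j)

/-- The dissipation `∑_i x_i (h_i(x) / N - 1)^2`. -/
noncomputable def dissip (x : Fin m → ℝ) : ℝ :=
  ∑ i, x i * (nbrInv G x i / (G.edgeFinset.card : ℝ) - 1) ^ 2

/-- The Lyapunov function. -/
noncomputable def lyap (x : Fin m → ℝ) : ℝ :=
  ∑ i, ∑ j ∈ G.neighborFinset i, Real.log (x i + x j)

lemma sum_nbr_swap (f : Fin m → Fin m → ℝ) :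
    ∑ i, ∑ j ∈ G.neighborFinset i, f i j = ∑ i, ∑ j ∈ G.neighborFinset i, f j i := by
  have h : ∀ g : Fin m → Fin m → ℝ, ∑ i, ∑ j ∈ G.neighborFinset i, g i j
      = ∑ i, ∑ j, if G.Adj i j then g i j else 0 := by
    intro g
    refine Finset.sum_congr rfl fun i _ => ?_
    rw [← Finset.sum_filter]
    refine Finset.sum_congr ?_ fun _ _ => rfl
    ext j
    simp
  rw [h, h, Finset.sum_comm]
  simp only [G.adj_comm]

lemma sum_nbr_const (a : ℝ) :
    ∑ i, ∑ _j ∈ G.neighborFinset i, a = 2 * (G.edgeFinset.card : ℝ) * a := by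
  simp only [Finset.sum_const, G.card_neighborFinset_eq_degree, nsmul_eq_mul]
  rw [← Finset.sum_mul]
  have := G.sum_degrees_eq_twice_card_edges
  have h2 : (∑ i, (G.degree i : ℝ)) = 2 * (G.edgeFinset.card : ℝ) := by exact_mod_cast this
  rw [h2]

/-- If `f i j + f j i = 1` on edges then the total is the number of edges. -/
lemma sum_nbr_of_add_eq_one (f : Fin m → Fin m → ℝ)
    (hf : ∀ i j, G.Adj i j → f i j + f j i = 1) :
    ∑ i, ∑ j ∈ G.neighborFinset i, f i j = (G.edgeFinset.card : ℝ) := by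
  have h1 := sum_nbr_swap G f
  have h2 : ∑ i, ∑ j ∈ G.neighborFinset i, f i j + ∑ i, ∑ j ∈ G.neighborFinset i, f j i
      = 2 * (G.edgeFinset.card : ℝ) * 1 := by
    rw [← sum_nbr_const, ← Finset.sum_add_distrib]
    refine Finset.sum_congr rfl fun i _ => ?_
    rw [← Finset.sum_add_distrib]
    refine Finset.sum_congr rfl fun j hj => ?_
    exact hf i j (by simpa using hj)
  linarith

lemma sum_nbr_add (d : Fin m → ℝ) (w : Fin m → Fin m → ℝ) (hw : ∀ i j, w i j = w j i) :
    ∑ i, ∑ j ∈ G.neighborFinset i, (d i + d j) * w i j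
      = 2 * ∑ i, d i * ∑ j ∈ G.neighborFinset i, w i j := by
  have h1 := sum_nbr_swap G (fun i j => d j * w i j)
  have h2 : ∀ i j, w j i = w i j := fun i j => hw j i
  simp only [h2] at h1
  simp only [add_mul, Finset.sum_add_distrib, Finset.mul_sum, h1]
  rw [← Finset.sum_add_distrib]
  refine Finset.sum_congr rfl fun i _ => ?_
  rw [← Finset.sum_add_distrib]
  exact Finset.sum_congr rfl fun j _ => by ring

lemma urnField_eq {x : Fin m → ℝ} (i : Fin m) :
    urnField m G 1 x i = x i * (nbrInv G x i / (G.edgeFinset.card : ℝ) - 1) := by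
  simp only [urnField, nbrInv, Real.rpow_one]
  have : ∑ j ∈ G.neighborFinset i, x i / (x i + x j)
      = x i * ∑ j ∈ G.neighborFinset i, 1 / (x i + x j) := by
    rw [Finset.mul_sum]
    refine Finset.sum_congr rfl fun j _ => by ring
  rw [this]
  ring

lemma sum_mul_nbrInv {c : ℝ} (hc : 0 < c) {x : Fin m → ℝ} (hx : x ∈ simplexDomain m G c) :
    ∑ i, x i * nbrInv G x i = (G.edgeFinset.card : ℝ) := by
  rw [← sum_nbr_of_add_eq_one G (fun i j => x i / (x i + x j))]
  · refine Finset.sum_congr rfl fun i _ => ?_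
    rw [nbrInv, Finset.mul_sum]
    refine Finset.sum_congr rfl fun j _ => by ring
  · intro i j hij
    have := hx.2.2 i j hij
    have h1 : x i + x j ≠ 0 := by linarith
    rw [add_comm (x j) (x i), ← add_div, div_self h1]

/-- `∑ F_i h_i = N D`. -/
lemma sum_field_mul {c : ℝ} (hc : 0 < c) (hN : 0 < (G.edgeFinset.card : ℝ))
    {x : Fin m → ℝ} (hx : x ∈ simplexDomain m G c) :
    ∑ i, (x i * (nbrInv G x i / (G.edgeFinset.card : ℝ) - 1)) * nbrInv G x i
      = (G.edgeFinset.card : ℝ) * dissip G x := by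
  have h1 := sum_mul_nbrInv G hc hx
  have h2 := hx.2.1
  unfold dissip
  set N : ℝ := (G.edgeFinset.card : ℝ)
  have h3 : N * (∑ i, x i * (nbrInv G x i / N - 1) ^ 2) - ∑ i, (x i * (nbrInv G x i / N - 1)) * nbrInv G x i
      = N * ∑ i, x i - ∑ i, x i * nbrInv G x i := by
    rw [Finset.mul_sum, Finset.mul_sum, ← Finset.sum_sub_distrib, ← Finset.sum_sub_distrib]
    refine Finset.sum_congr rfl fun i _ => ?_
    field_simp
    ring
  rw [h1, h2] at h3
  linarith

lemma dissip_nonneg {c : ℝ} {x : Fin m → ℝ} (hx : x ∈ simplexDomain m G c) : 0 ≤ dissip G x :=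
  Finset.sum_nonneg fun i _ => mul_nonneg (hx.1 i) (sq_nonneg _)

lemma mem_equilibria_of_dissip {c : ℝ} {x : Fin m → ℝ} (hx : x ∈ simplexDomain m G c)
    (h : dissip G x = 0) : x ∈ equilibria m G 1 c := by
  refine ⟨hx, ?_⟩
  funext i
  rw [urnField_eq]
  have := (Finset.sum_eq_zero_iff_of_nonneg
    (fun i _ => mul_nonneg (hx.1 i) (sq_nonneg _))).1 h i (Finset.mem_univ i)
  simpa using this

lemma isCompact_simplexDomain (c : ℝ) : IsCompact (simplexDomain m G c) := by
  have hsub : simplexDomain m G c ⊆ Set.Icc 0 1 := by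
    intro x hx
    refine ⟨fun i => hx.1 i, fun i => ?_⟩
    have h := hx.2.1
    have := Finset.single_le_sum (f := x) (fun j _ => hx.1 j) (Finset.mem_univ i)
    simp only [Pi.one_apply]
    linarith
  refine isCompact_Icc.of_isClosed_subset ?_ hsub
  have : simplexDomain m G c = (⋂ i, {x | 0 ≤ x i}) ∩ ({x | (∑ i, x i) = 1} ∩
      ⋂ i, ⋂ j, ⋂ (_ : G.Adj i j), {x | c ≤ x i + x j}) := by
    ext x
    simp [simplexDomain]
  rw [this]
  refine (isClosed_iInter fun i => isClosed_le (by fun_prop) (by fun_prop)).inter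
    ((isClosed_eq (by fun_prop) (by fun_prop)).inter
      (isClosed_iInter fun i => isClosed_iInter fun j => isClosed_iInter fun _ =>
        isClosed_le (by fun_prop) (by fun_prop)))

lemma continuousOn_dissip {c : ℝ} (hc : 0 < c) :
    ContinuousOn (dissip G) (simplexDomain m G c) := by
  unfold dissip nbrInv
  refine continuousOn_finsetSum _ fun i _ => ?_
  refine ContinuousOn.mul (by fun_prop) (ContinuousOn.pow (ContinuousOn.sub
    (ContinuousOn.div_const ?_ _) continuousOn_const) 2)
  refine continuousOn_finsetSum _ fun j hj => ?_
  refine ContinuousOn.div continuousOn_const (by fun_prop) ?_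
  intro x hx
  have := hx.2.2 i j (by simpa using hj)
  linarith

/-- One step lower bound for the Lyapunov function. -/
lemma lyap_step {c e : ℝ} (hc : 0 < c) {x y : Fin m → ℝ}
    (hx : x ∈ simplexDomain m G c) (hy : y ∈ simplexDomain m G c)
    (hxy : ∀ i, |y i - x i| ≤ e) :
    2 * ∑ i, (y i - x i) * nbrInv G x i - 2 * (G.edgeFinset.card : ℝ) * (4 * e ^ 2 / c ^ 2)
      ≤ lyap G y - lyap G x := by
  unfold nbrInv
  rw [← sum_nbr_add G (fun i => y i - x i) (fun i j => 1 / (x i + x j))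
    (fun i j => by rw [add_comm]), ← sum_nbr_const, lyap, lyap, ← Finset.sum_sub_distrib,
    ← Finset.sum_sub_distrib]
  refine Finset.sum_le_sum fun i _ => ?_
  rw [← Finset.sum_sub_distrib, ← Finset.sum_sub_distrib]
  refine Finset.sum_le_sum fun j hj => ?_
  have hij : G.Adj i j := by simpa using hj
  have h1 := hx.2.2 i j hij
  have h2 := hy.2.2 i j hij
  have hi := hxy i
  have hj := hxy j
  have hd : y i - x i + (y j - x j) = (y i + y j) - (x i + x j) := by ring
  have hsq : ((y i + y j) - (x i + x j)) ^ 2 ≤ 4 * e ^ 2 := by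
    rw [← hd]
    have h3 := abs_add_le (y i - x i) (y j - x j)
    have h4 : |y i - x i + (y j - x j)| ≤ 2 * e := by linarith
    have := sq_le_sq' (by linarith [(abs_le.1 h4).1]) (abs_le.1 h4).2
    linarith
  rw [hd]
  set s := x i + x j
  set t := y i + y j
  have hs : 0 < s := by linarith
  have ht : 0 < t := by linarith
  have hlog := Real.one_sub_inv_le_log_of_pos (div_pos ht hs)
  rw [Real.log_div ht.ne' hs.ne', inv_div] at hlog
  have heq : (t - s) * (1 / s) - (t - s) ^ 2 / (s * t) = 1 - s / t := by
    field_simp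
    ring
  have hb : (t - s) ^ 2 / (s * t) ≤ 4 * e ^ 2 / c ^ 2 := by
    apply div_le_div₀ (by positivity) hsq (by positivity)
    nlinarith
  linarith

lemma lyap_bounds {c : ℝ} (hc : 0 < c) {x : Fin m → ℝ} (hx : x ∈ simplexDomain m G c) :
    2 * (G.edgeFinset.card : ℝ) * Real.log c ≤ lyap G x ∧ lyap G x ≤ 0 := by
  constructor
  · rw [← sum_nbr_const, lyap]
    refine Finset.sum_le_sum fun i _ => Finset.sum_le_sum fun j hj => ?_
    exact Real.log_le_log hc (hx.2.2 i j (by simpa using hj))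
  · refine Finset.sum_nonpos fun i _ => Finset.sum_nonpos fun j hj => ?_
    have hij : G.Adj i j := by simpa using hj
    have h1 := hx.2.2 i j hij
    apply Real.log_nonpos (by linarith)
    have h := hx.2.1
    have := Finset.sum_le_sum_of_subset_of_nonneg (f := x) (Finset.subset_univ {i, j})
      (fun k _ _ => hx.1 k)
    rw [Finset.sum_pair hij.ne] at this
    linarith

/-- Two equilibria with the same support coincide. -/
lemma equilibria_inj {c : ℝ} (hc : 0 < c) (hN : 0 < (G.edgeFinset.card : ℝ)) (hconn : G.Connected)
    (hnbb : ¬ ∃ A : Finset (Fin m), (∀ i j, G.Adj i j → (i ∈ A ↔ j ∉ A)) ∧ 2 * A.card = m)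
    {x y : Fin m → ℝ} (hx : x ∈ equilibria m G 1 c) (hy : y ∈ equilibria m G 1 c)
    (hsupp : ∀ i, x i = 0 ↔ y i = 0) : x = y := by
  have hcrit : ∀ z ∈ equilibria m G 1 c, ∀ i, z i ≠ 0 →
      nbrInv G z i = (G.edgeFinset.card : ℝ) := by
    intro z hz i hi
    have := congrFun hz.2 i
    rw [urnField_eq] at this
    simp only [Pi.zero_apply, mul_eq_zero, hi, false_or] at this
    have h2 : nbrInv G z i / (G.edgeFinset.card : ℝ) = 1 := by linarith
    rwa [div_eq_one_iff_eq hN.ne'] at h2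
  set u : Fin m → ℝ := fun i => y i - x i with hu
  have hzero : ∑ i, u i * (nbrInv G x i - nbrInv G y i) = 0 := by
    refine Finset.sum_eq_zero fun i _ => ?_
    by_cases hi : x i = 0
    · simp [hu, hi, (hsupp i).1 hi]
    · rw [hcrit x hx i hi, hcrit y hy i (fun h => hi ((hsupp i).2 h))]
      simp
  have h2 : ∑ i, ∑ j ∈ G.neighborFinset i,
      (u i + u j) * (1 / (x i + x j) - 1 / (y i + y j)) = 0 := by
    rw [sum_nbr_add G u (fun i j => 1 / (x i + x j) - 1 / (y i + y j))
      (fun i j => by rw [add_comm (x i), add_comm (y i)])]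
    simp only [Finset.sum_sub_distrib]
    simp only [nbrInv] at hzero
    rw [hzero, mul_zero]
  have hterm : ∀ i, ∀ j ∈ G.neighborFinset i,
      (u i + u j) * (1 / (x i + x j) - 1 / (y i + y j))
        = (u i + u j) ^ 2 / ((x i + x j) * (y i + y j)) ∧ 0 < (x i + x j) * (y i + y j) := by
    intro i j hj
    have hij : G.Adj i j := by simpa using hj
    have h1 := hx.1.2.2 i j hij
    have h2 := hy.1.2.2 i j hij
    have h3 : 0 < x i + x j := by linarith
    have h4 : 0 < y i + y j := by linarith
    refine ⟨?_, by positivity⟩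
    simp only [hu]
    field_simp
    ring
  have hnn : ∀ i, ∀ j ∈ G.neighborFinset i,
      0 ≤ (u i + u j) * (1 / (x i + x j) - 1 / (y i + y j)) := by
    intro i j hj
    obtain ⟨h1, h2⟩ := hterm i j hj
    rw [h1]
    positivity
  have hedge : ∀ i j, G.Adj i j → u j = - u i := by
    intro i j hij
    have hj : j ∈ G.neighborFinset i := by simpa using hij
    have h3 := (Finset.sum_eq_zero_iff_of_nonneg
      (fun i _ => Finset.sum_nonneg (hnn i))).1 h2 i (Finset.mem_univ i)
    have h4 := (Finset.sum_eq_zero_iff_of_nonneg (hnn i)).1 h3 j hj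
    obtain ⟨h5, h6⟩ := hterm i j hj
    rw [h5, div_eq_zero_iff] at h4
    rcases h4 with h4 | h4
    · have := pow_eq_zero_iff (two_ne_zero) |>.1 h4
      linarith
    · linarith
  have habs : ∀ i j, |u i| = |u j| := by
    intro i j
    obtain ⟨w⟩ := hconn.preconnected i j
    induction w with
    | nil => rfl
    | cons h _ ih => rw [← ih, hedge _ _ h, abs_neg]
  have husum : ∑ i, u i = 0 := by
    simp only [hu, Finset.sum_sub_distrib]
    rw [hx.1.2.1, hy.1.2.1, sub_self]
  obtain ⟨i0⟩ := hconn.nonempty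
  by_cases h0 : u i0 = 0
  · funext i
    have := habs i i0
    rw [h0, abs_zero, abs_eq_zero] at this
    simp only [hu] at this
    linarith
  · exfalso
    apply hnbb
    have hne : ∀ i, u i ≠ 0 := by
      intro i hi
      have := habs i0 i
      rw [hi, abs_zero, abs_eq_zero] at this
      exact h0 this
    refine ⟨Finset.univ.filter fun i => 0 < u i, ?_, ?_⟩
    · intro i j hij
      have h1 := hedge i j hij
      have h2 := hne i
      simp only [Finset.mem_filter, Finset.mem_univ, true_and, h1]
      constructor
      · intro h; linarith
      · intro h
        rcases lt_or_gt_of_ne h2 with h3 | h3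
        · exfalso; apply h; linarith
        · exact h3
    · have hval : ∀ i, u i = |u i0| * ((if 0 < u i then 2 else 0) - 1) := by
        intro i
        rw [← habs i i0]
        split_ifs with h
        · rw [abs_of_pos h]; ring
        · rw [abs_of_nonpos (not_lt.1 h)]; ring
      have h1 : ∑ i, |u i0| * (((if 0 < u i then 2 else 0) : ℝ) - 1) = 0 := by
        refine Eq.trans ?_ husum
        exact Finset.sum_congr rfl fun i _ => (hval i).symm
      rw [← Finset.mul_sum, mul_eq_zero] at h1
      rcases h1 with h1 | h1
      · exact absurd (abs_eq_zero.1 h1) h0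
      · rw [Finset.sum_sub_distrib, ← Finset.sum_filter] at h1
        simp only [Finset.sum_const, nsmul_eq_mul, Finset.card_univ, Fintype.card_fin, mul_one] at h1
        have h3 : (2 * (Finset.univ.filter fun i => 0 < u i).card : ℝ) = m := by linarith
        exact_mod_cast h3

lemma equilibria_finite {c : ℝ} (hc : 0 < c) (hN : 0 < (G.edgeFinset.card : ℝ))
    (hconn : G.Connected)
    (hnbb : ¬ ∃ A : Finset (Fin m), (∀ i j, G.Adj i j → (i ∈ A ↔ j ∉ A)) ∧ 2 * A.card = m) :
    (equilibria m G 1 c).Finite := by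
  refine Set.Finite.of_finite_image (f := fun x : Fin m → ℝ => {i | x i = 0}) (Set.toFinite _) ?_
  intro x hx y hy hxy
  refine equilibria_inj G hc hN hconn hnbb hx hy fun i => ?_
  exact (Set.ext_iff.1 hxy i)

end Deterministic

section Counting

variable {m : ℕ} (G : SimpleGraph (Fin m)) [DecidableRel G.Adj]

lemma urn_total {b : ℕ → Fin m → ℕ} {d : ℕ → Fin m → Fin m → ℕ}
    (hd : ∀ n i j, G.Adj i j → d n i j + d n j i = 1)
    (hb : ∀ n i, b (n + 1) i = b n i + ∑ j ∈ G.neighborFinset i, d (n + 1) i j) (n : ℕ) :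
    ∑ i, (b n i : ℝ) = ((∑ j, b 0 j) + n * G.edgeFinset.card : ℕ) := by
  induction n with
  | zero => simp
  | succ n ih =>
    have h := sum_nbr_of_add_eq_one G (fun i j => (d (n + 1) i j : ℝ))
      (fun i j hij => by exact_mod_cast hd (n + 1) i j hij)
    simp only [hb]
    push_cast at *
    rw [Finset.sum_add_distrib, ih, h]
    ring

lemma urn_edge {b : ℕ → Fin m → ℕ} {d : ℕ → Fin m → Fin m → ℕ}
    (hb0 : ∀ i, 1 ≤ b 0 i)
    (hd : ∀ n i j, G.Adj i j → d n i j + d n j i = 1)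
    (hb : ∀ n i, b (n + 1) i = b n i + ∑ j ∈ G.neighborFinset i, d (n + 1) i j)
    {i j : Fin m} (hij : G.Adj i j) (n : ℕ) : n + 1 ≤ b n i + b n j := by
  induction n with
  | zero => have := hb0 i; omega
  | succ n ih =>
    have h1 := Finset.single_le_sum (f := fun j => d (n + 1) i j) (fun _ _ => Nat.zero_le _)
      (show j ∈ G.neighborFinset i by simpa using hij)
    have h2 := Finset.single_le_sum (f := fun i => d (n + 1) j i) (fun _ _ => Nat.zero_le _)
      (show i ∈ G.neighborFinset j by simpa using hij.symm)
    have h3 := hd (n + 1) i j hij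
    have h4 := hb n i
    have h5 := hb n j
    omega

/-- Deterministic properties of the proportions along a trajectory. -/
lemma urn_traj {b : ℕ → Fin m → ℕ} {d : ℕ → Fin m → Fin m → ℕ}
    (hN : 0 < G.edgeFinset.card) (S : ℕ) (hS : 0 < S) (hSb : ∑ j, b 0 j = S)
    (hb0 : ∀ i, 1 ≤ b 0 i)
    (hd : ∀ n i j, G.Adj i j → d n i j + d n j i = 1)
    (hb : ∀ n i, b (n + 1) i = b n i + ∑ j ∈ G.neighborFinset i, d (n + 1) i j)
    (x : ℕ → Fin m → ℝ)
    (hx : ∀ n i, x n i = (b n i : ℝ) / ((S : ℝ) + n * G.edgeFinset.card)) :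
    (∀ n, x n ∈ simplexDomain m G (1 / ((S : ℝ) + G.edgeFinset.card))) ∧
    (∀ n i, x (n + 1) i - x n i = (G.edgeFinset.card : ℝ) /
        ((S : ℝ) + (n + 1) * G.edgeFinset.card) *
        ((∑ j ∈ G.neighborFinset i, (d (n + 1) i j : ℝ)) / G.edgeFinset.card - x n i)) ∧
    (∀ n i, |x (n + 1) i - x n i| ≤ 1 / ((n : ℝ) + 1)) ∧
    (∀ c : ℝ, c < 1 / (G.edgeFinset.card : ℝ) → ∀ᶠ n in atTop, x n ∈ simplexDomain m G c) := by
  have htot := urn_total G hd hb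
  rw [hSb] at htot
  have hedge := fun i j hij => urn_edge G hb0 hd hb (i := i) (j := j) hij
  have hdsum := fun n => sum_nbr_of_add_eq_one G (fun i j => (d (n + 1) i j : ℝ))
      (fun i j hij => by exact_mod_cast hd (n + 1) i j hij)
  have hNR : (0 : ℝ) < G.edgeFinset.card := by exact_mod_cast hN
  have hSR : (0 : ℝ) < S := by exact_mod_cast hS
  have hbR : ∀ n i, (b (n + 1) i : ℝ) = b n i + ∑ j ∈ G.neighborFinset i, (d (n + 1) i j : ℝ) := by
    intro n i
    rw [hb]
    push_cast
    rfl
  push_cast at htot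
  generalize (G.edgeFinset.card : ℝ) = N at *
  have hT : ∀ n : ℕ, 0 < (S : ℝ) + n * N := fun n => by positivity
  have hnn : ∀ n i, 0 ≤ x n i := fun n i => by
    rw [hx]
    exact div_nonneg (Nat.cast_nonneg _) (hT n).le
  have hone : ∀ n, ∑ i, x n i = 1 := fun n => by
    simp only [hx]
    rw [← Finset.sum_div, htot, div_self (hT n).ne']
  have hsum : ∀ (n : ℕ) i j, G.Adj i j → ((n : ℝ) + 1) / ((S : ℝ) + n * N) ≤ x n i + x n j := by
    intro n i j hij
    rw [hx, hx, ← add_div]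
    apply div_le_div_of_nonneg_right _ (hT n).le
    exact_mod_cast hedge i j hij n
  have hstep : ∀ (n : ℕ) i, x (n + 1) i - x n i = N / ((S : ℝ) + (n + 1) * N) *
        ((∑ j ∈ G.neighborFinset i, (d (n + 1) i j : ℝ)) / N - x n i) := by
    intro n i
    have h1 := hT n
    have h2 := hT (n + 1)
    rw [hx, hx, hbR]
    push_cast at *
    field_simp
    ring
  refine ⟨fun n => ⟨hnn n, hone n, fun i j hij => le_trans ?_ (hsum n i j hij)⟩, hstep, ?_, ?_⟩
  · rw [div_le_div_iff₀ (by positivity) (hT n)]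
    nlinarith [(Nat.cast_nonneg n : (0 : ℝ) ≤ n), mul_nonneg (Nat.cast_nonneg n : (0 : ℝ) ≤ n) hSR.le]
  · intro n i
    rw [hstep]
    have hT1 : 0 < (S : ℝ) + (n + 1) * N := by positivity
    have h1 : x n i ≤ 1 := by
      rw [← hone n]
      exact Finset.single_le_sum (f := x n) (fun j _ => hnn n j) (Finset.mem_univ i)
    have h2 : 0 ≤ ∑ j ∈ G.neighborFinset i, (d (n + 1) i j : ℝ) :=
      Finset.sum_nonneg fun _ _ => Nat.cast_nonneg _
    have h3 : ∑ j ∈ G.neighborFinset i, (d (n + 1) i j : ℝ) ≤ N := by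
      rw [← hdsum n]
      exact Finset.single_le_sum (f := fun i => ∑ j ∈ G.neighborFinset i, (d (n + 1) i j : ℝ))
        (fun _ _ => Finset.sum_nonneg fun _ _ => Nat.cast_nonneg _) (Finset.mem_univ i)
    have h4 : (∑ j ∈ G.neighborFinset i, (d (n + 1) i j : ℝ)) / N ≤ 1 := (div_le_one hNR).2 h3
    have h5 : 0 ≤ (∑ j ∈ G.neighborFinset i, (d (n + 1) i j : ℝ)) / N := div_nonneg h2 hNR.le
    have h6 : |(∑ j ∈ G.neighborFinset i, (d (n + 1) i j : ℝ)) / N - x n i| ≤ 1 := by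
      rw [abs_le]
      constructor <;> linarith [hnn n i]
    have h7 : N / ((S : ℝ) + (n + 1) * N) ≤ 1 / ((n : ℝ) + 1) := by
      rw [div_le_div_iff₀ hT1 (by positivity)]
      nlinarith
    rw [abs_mul, abs_of_nonneg (by positivity : 0 ≤ N / ((S : ℝ) + (n + 1) * N))]
    calc _ ≤ 1 / ((n : ℝ) + 1) * 1 := mul_le_mul h7 h6 (abs_nonneg _) (by positivity)
      _ = _ := mul_one _
  · intro c hc
    have hev : ∀ᶠ n : ℕ in atTop, c ≤ ((n : ℝ) + 1) / ((S : ℝ) + n * N) := by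
      have hcN : 0 < 1 - c * N := by
        rw [lt_div_iff₀ hNR] at hc
        linarith
      obtain ⟨n0, hn0⟩ := exists_nat_gt (c * S / (1 - c * N))
      filter_upwards [eventually_ge_atTop n0] with n hn
      have h1 : (n0 : ℝ) ≤ n := by exact_mod_cast hn
      rw [div_lt_iff₀ hcN] at hn0
      rw [le_div_iff₀ (hT n)]
      nlinarith
    filter_upwards [hev] with n hn
    exact ⟨hnn n, hone n, fun i j hij => hn.trans (hsum n i j hij)⟩

end Counting

section Probability

lemma integral_sub_mul_eq_zero {Ω : Type*} {msub mΩ : MeasurableSpace Ω} {μ : Measure Ω}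
    [IsProbabilityMeasure μ] (hm : msub ≤ mΩ) {f p h : Ω → ℝ}
    (hf : Integrable f μ) (hp : μ[f | msub] =ᵐ[μ] p) (hpi : Integrable p μ)
    (hh : StronglyMeasurable[msub] h) (C : ℝ) (hC : ∀ ω, |h ω| ≤ C) :
    Integrable (fun ω => (f ω - p ω) * h ω) μ ∧ ∫ ω, (f ω - p ω) * h ω ∂μ = 0 := by
  have hh' : AEStronglyMeasurable h μ := (hh.mono hm).aestronglyMeasurable
  have h1 : Integrable (fun ω => f ω * h ω) μ :=
    hf.mul_bdd (c := C) hh' (Eventually.of_forall hC)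
  have h2 : Integrable (fun ω => p ω * h ω) μ :=
    hpi.mul_bdd (c := C) hh' (Eventually.of_forall hC)
  have hce : μ[f * h | msub] =ᵐ[μ] μ[f | msub] * h := condExp_mul_of_stronglyMeasurable_right hh h1 hf
  have h3 : ∫ ω, f ω * h ω ∂μ = ∫ ω, p ω * h ω ∂μ := by
    calc ∫ ω, f ω * h ω ∂μ = ∫ ω, (μ[f * h | msub]) ω ∂μ := (integral_condExp hm).symm
      _ = ∫ ω, p ω * h ω ∂μ := by
        refine integral_congr_ae ?_
        filter_upwards [hce, hp] with ω ha hb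
        rw [ha, Pi.mul_apply, hb]
  simp only [sub_mul]
  refine ⟨h1.sub h2, ?_⟩
  rw [integral_sub h1 h2, h3, sub_self]

lemma ae_summable_of_summable_integral {Ω : Type*} {mΩ : MeasurableSpace Ω} {μ : Measure Ω}
    {f : ℕ → Ω → ℝ} (hf0 : ∀ n ω, 0 ≤ f n ω) (hfi : ∀ n, Integrable (f n) μ)
    (hs : Summable fun n => ∫ ω, f n ω ∂μ) : ∀ᵐ ω ∂μ, Summable fun n => f n ω := by
  have hmeas : ∀ n, AEMeasurable (fun ω => ENNReal.ofReal (f n ω)) μ :=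
    fun n => (hfi n).aemeasurable.ennreal_ofReal
  have h1 : ∫⁻ ω, ∑' n, ENNReal.ofReal (f n ω) ∂μ ≠ ⊤ := by
    rw [lintegral_tsum hmeas]
    have : ∀ n, ∫⁻ ω, ENNReal.ofReal (f n ω) ∂μ = ENNReal.ofReal (∫ ω, f n ω ∂μ) := fun n =>
      (ofReal_integral_eq_lintegral_ofReal (hfi n) (Eventually.of_forall (hf0 n))).symm
    simp only [this]
    exact hs.tsum_ofReal_ne_top
  filter_upwards [ae_lt_top' (AEMeasurable.tsum hmeas) h1] with ω hω
  have := ENNReal.summable_toReal hω.ne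
  simpa [ENNReal.toReal_ofReal (hf0 _ ω)] using this

variable {m : ℕ} (G : SimpleGraph (Fin m)) [DecidableRel G.Adj]

lemma summable_dissip {Ω : Type*} {mΩ : MeasurableSpace Ω} {μ : Measure Ω}
    [IsProbabilityMeasure μ] (ℱ : Filtration ℕ mΩ)
    (δ : ℕ → Fin m → Fin m → Ω → ℝ) (x : ℕ → Ω → Fin m → ℝ) {c κ : ℝ} (hc : 0 < c) (hκ : 0 < κ)
    (γ : ℕ → ℝ) (hγ : ∀ n : ℕ, κ / ((n : ℝ) + 1) ≤ γ n) (hN : 0 < (G.edgeFinset.card : ℝ))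
    (hxm : ∀ n i, Measurable[ℱ n] fun ω => x n ω i)
    (hδi : ∀ n i j, G.Adj i j → Integrable (δ n i j) μ)
    (hxK : ∀ n ω, x n ω ∈ simplexDomain m G c)
    (hstep : ∀ n ω i, |x (n + 1) ω i - x n ω i| ≤ 1 / ((n : ℝ) + 1))
    (hrec : ∀ n ω i, x (n + 1) ω i - x n ω i = γ n *
      ((∑ j ∈ G.neighborFinset i, δ (n + 1) i j ω) / G.edgeFinset.card - x n ω i))
    (hlaw : ∀ n i j, G.Adj i j → μ[δ (n + 1) i j | ℱ n] =ᵐ[μ]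
      fun ω => x n ω i / (x n ω i + x n ω j)) :
    ∀ᵐ ω ∂μ, Summable fun n => dissip G (x n ω) / ((n : ℝ) + 1) := by
  set N : ℝ := (G.edgeFinset.card : ℝ) with hNdef
  have hxm' : ∀ n i, Measurable fun ω => x n ω i := fun n i => (hxm n i).mono (ℱ.le n) le_rfl
  have hhm : ∀ n i, Measurable[ℱ n] fun ω => nbrInv G (x n ω) i := by
    intro n i
    unfold nbrInv
    refine Finset.measurable_sum _ fun j _ => ?_
    exact Measurable.div measurable_const ((hxm n i).add (hxm n j))
  have hhm' : ∀ n i, Measurable fun ω => nbrInv G (x n ω) i :=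
    fun n i => (hhm n i).mono (ℱ.le n) le_rfl
  have hDm : ∀ n, Measurable fun ω => dissip G (x n ω) := by
    intro n
    unfold dissip
    refine Finset.measurable_sum _ fun i _ => ?_
    exact (hxm' n i).mul ((((hhm' n i).div_const _).sub_const _).pow_const 2)
  have hLm : ∀ n, Measurable fun ω => lyap G (x n ω) := by
    intro n
    unfold lyap
    refine Finset.measurable_sum _ fun i _ => Finset.measurable_sum _ fun j _ => ?_
    exact Real.measurable_log.comp ((hxm' n i).add (hxm' n j))
  obtain ⟨CD, hCD⟩ := (isCompact_simplexDomain G c).exists_bound_of_continuousOn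
    (continuousOn_dissip G hc)
  have hDi : ∀ n, Integrable (fun ω => dissip G (x n ω)) μ := fun n =>
    Integrable.of_bound (hDm n).aestronglyMeasurable CD (Eventually.of_forall fun ω => hCD _ (hxK n ω))
  have hLi : ∀ n, Integrable (fun ω => lyap G (x n ω)) μ := fun n =>
    Integrable.of_bound (hLm n).aestronglyMeasurable (-(2 * N * Real.log c))
      (Eventually.of_forall fun ω => by
        obtain ⟨h1, h2⟩ := lyap_bounds G hc (hxK n ω)
        rw [Real.norm_eq_abs, abs_of_nonpos h2]
        linarith)
  have hhb : ∀ n i ω, |nbrInv G (x n ω) i| ≤ (G.degree i : ℝ) * (1 / c) := by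
    intro n i ω
    unfold nbrInv
    refine (Finset.abs_sum_le_sum_abs _ _).trans ?_
    rw [← G.card_neighborFinset_eq_degree, ← nsmul_eq_mul]
    refine Finset.sum_le_card_nsmul _ _ _ fun j hj => ?_
    have := (hxK n ω).2.2 i j (by simpa using hj)
    rw [abs_of_nonneg (by apply div_nonneg zero_le_one; linarith)]
    exact one_div_le_one_div_of_le hc this
  have hpi : ∀ n i j, G.Adj i j → Integrable (fun ω => x n ω i / (x n ω i + x n ω j)) μ := by
    intro n i j hij
    refine Integrable.of_bound ((hxm' n i).div ((hxm' n i).add (hxm' n j))).aestronglyMeasurable 1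
      (Eventually.of_forall fun ω => ?_)
    have h1 := (hxK n ω).2.2 i j hij
    have h2 := (hxK n ω).1 i
    have h3 := (hxK n ω).1 j
    rw [Real.norm_eq_abs, abs_of_nonneg (div_nonneg h2 (by linarith)), div_le_one (by linarith)]
    linarith
  -- the noise
  set R : ℕ → Ω → ℝ := fun n ω => ∑ i, ∑ j ∈ G.neighborFinset i, (γ n / N) *
    ((δ (n + 1) i j ω - x n ω i / (x n ω i + x n ω j)) * nbrInv G (x n ω) i) with hR
  have hnoise : ∀ n i, ∀ j ∈ G.neighborFinset i, Integrable (fun ω => (γ n / N) *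
      ((δ (n + 1) i j ω - x n ω i / (x n ω i + x n ω j)) * nbrInv G (x n ω) i)) μ ∧
      ∫ ω, (γ n / N) * ((δ (n + 1) i j ω - x n ω i / (x n ω i + x n ω j)) *
        nbrInv G (x n ω) i) ∂μ = 0 := by
    intro n i j hj
    have hij : G.Adj i j := by simpa using hj
    obtain ⟨h1, h2⟩ := integral_sub_mul_eq_zero (ℱ.le n) (hδi (n + 1) i j hij) (hlaw n i j hij)
      (hpi n i j hij) (hhm n i).stronglyMeasurable _ (hhb n i)
    exact ⟨h1.const_mul _, by rw [integral_const_mul, h2, mul_zero]⟩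
  have hRi : ∀ n, Integrable (R n) μ := fun n =>
    integrable_finsetSum _ fun i _ => integrable_finsetSum _ fun j hj => (hnoise n i j hj).1
  have hR0 : ∀ n, ∫ ω, R n ω ∂μ = 0 := by
    intro n
    simp only [hR]
    rw [integral_finsetSum _ fun i _ => integrable_finsetSum _ fun j hj => (hnoise n i j hj).1]
    refine Finset.sum_eq_zero fun i _ => ?_
    rw [integral_finsetSum _ fun j hj => (hnoise n i j hj).1]
    exact Finset.sum_eq_zero fun j hj => (hnoise n i j hj).2
  have hdrift : ∀ n ω, ∑ i, (x (n + 1) ω i - x n ω i) * nbrInv G (x n ω) i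
      = γ n * (N * dissip G (x n ω)) + R n ω := by
    intro n ω
    rw [← sum_field_mul G hc hN (hxK n ω), hR, Finset.mul_sum, ← Finset.sum_add_distrib]
    refine Finset.sum_congr rfl fun i _ => ?_
    rw [hrec, ← Finset.mul_sum, ← Finset.sum_mul, Finset.sum_sub_distrib]
    have : ∑ j ∈ G.neighborFinset i, x n ω i / (x n ω i + x n ω j)
        = x n ω i * nbrInv G (x n ω) i := by
      rw [nbrInv, Finset.mul_sum]
      refine Finset.sum_congr rfl fun j _ => by ring
    rw [this, ← hNdef]
    field_simp
    ring
  set A : ℝ := 2 * N * (4 / c ^ 2) with hA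
  have hpt : ∀ n ω, 2 * (γ n * (N * dissip G (x n ω)) + R n ω) - A * (1 / ((n : ℝ) + 1) ^ 2)
      ≤ lyap G (x (n + 1) ω) - lyap G (x n ω) := by
    intro n ω
    have := lyap_step G hc (hxK n ω) (hxK (n + 1) ω) (hstep n ω)
    rw [hdrift] at this
    refine le_trans (le_of_eq ?_) this
    rw [hA, ← hNdef]
    congr 1
    field_simp
  have hinteg : ∀ n, 2 * γ n * N * ∫ ω, dissip G (x n ω) ∂μ - A * (1 / ((n : ℝ) + 1) ^ 2)
      ≤ ∫ ω, lyap G (x (n + 1) ω) ∂μ - ∫ ω, lyap G (x n ω) ∂μ := by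
    intro n
    have i1 : Integrable (fun ω => γ n * (N * dissip G (x n ω))) μ :=
      ((hDi n).const_mul N).const_mul (γ n)
    have i2 : Integrable (fun ω => 2 * (γ n * (N * dissip G (x n ω)) + R n ω)) μ :=
      (i1.add (hRi n)).const_mul 2
    have h := integral_mono (i2.sub (integrable_const (A * (1 / ((n : ℝ) + 1) ^ 2))))
      ((hLi (n + 1)).sub (hLi n)) (hpt n)
    simp only [Pi.sub_apply] at h
    rw [integral_sub (hLi (n + 1)) (hLi n), integral_sub i2 (integrable_const _),
      integral_const_mul, integral_add i1 (hRi n), integral_const_mul, integral_const_mul,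
      hR0 n, integral_const] at h
    simp only [probReal_univ, one_smul] at h
    linarith
  set a : ℕ → ℝ := fun n => ∫ ω, dissip G (x n ω) ∂μ with ha
  have ha0 : ∀ n, 0 ≤ a n := fun n => integral_nonneg fun ω => dissip_nonneg G (hxK n ω)
  have hAs : Summable fun n : ℕ => A * (1 / ((n : ℝ) + 1) ^ 2) := by
    have h1 : Summable fun n : ℕ => 1 / ((n : ℝ)) ^ 2 :=
      Real.summable_one_div_nat_pow.2 one_lt_two
    have h2 := (summable_nat_add_iff 1).2 h1
    push_cast at h2
    exact h2.mul_left A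
  have hLb : ∀ n, 2 * N * Real.log c ≤ ∫ ω, lyap G (x n ω) ∂μ ∧ ∫ ω, lyap G (x n ω) ∂μ ≤ 0 := by
    intro n
    constructor
    · have := integral_mono (integrable_const (2 * N * Real.log c)) (hLi n)
        (fun ω => (lyap_bounds G hc (hxK n ω)).1)
      simpa using this
    · exact integral_nonpos fun ω => (lyap_bounds G hc (hxK n ω)).2
  have hsum : Summable fun n : ℕ => (2 * κ * N) * (a n / ((n : ℝ) + 1)) := by
    refine summable_of_sum_range_le (c := -(2 * N * Real.log c) +
      ∑' n : ℕ, A * (1 / ((n : ℝ) + 1) ^ 2)) (fun n => ?_) fun n => ?_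
    · have := ha0 n
      positivity
    · have h1 : ∑ k ∈ Finset.range n, (2 * κ * N) * (a k / ((k : ℝ) + 1))
          ≤ ∑ k ∈ Finset.range n, ((∫ ω, lyap G (x (k + 1) ω) ∂μ - ∫ ω, lyap G (x k ω) ∂μ) +
            A * (1 / ((k : ℝ) + 1) ^ 2)) := by
        refine Finset.sum_le_sum fun k _ => ?_
        have h2 := hinteg k
        have h3 : (2 * κ * N) * (a k / ((k : ℝ) + 1)) ≤ 2 * γ k * N * a k := by
          have h4 := mul_le_mul_of_nonneg_right (hγ k) (mul_nonneg hN.le (ha0 k))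
          calc _ = 2 * (κ / ((k : ℝ) + 1) * (N * a k)) := by ring
            _ ≤ 2 * (γ k * (N * a k)) := by linarith
            _ = _ := by ring
        linarith
      refine h1.trans ?_
      rw [Finset.sum_add_distrib, Finset.sum_range_sub (fun k => ∫ ω, lyap G (x k ω) ∂μ)]
      have h5 := hAs.sum_le_tsum (Finset.range n) (fun k _ => by positivity)
      linarith [(hLb 0).1, (hLb n).2]
  have hsum' : Summable fun n : ℕ => a n / ((n : ℝ) + 1) :=
    (summable_mul_left_iff (by positivity)).1 hsum
  refine ae_summable_of_summable_integral (fun n ω => ?_) (fun n => (hDi n).div_const _) ?_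
  · exact div_nonneg (dissip_nonneg G (hxK n ω)) (by positivity)
  · simpa only [integral_div] using hsum'

end Probability

/-- **Corollary 3.** For a finite, connected, not balanced bipartite graph `G` and `α = 1`,
the equilibria set `Λ` is finite and almost surely `x(n)` converges to an element of `Λ`. -/
theorem polya_urn_not_balanced_bipartite_converges
    {m : ℕ} {G : SimpleGraph (Fin m)} [DecidableRel G.Adj] {c : ℝ}
    (hconn : G.Connected)
    (hnbb : ¬ ∃ A : Finset (Fin m), (∀ i j, G.Adj i j → (i ∈ A ↔ j ∉ A)) ∧ 2 * A.card = m)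
    (hc : 0 < c) (hcN : c < 1 / (G.edgeFinset.card : ℝ))
    (P : GraphUrn m G 1) :
    (equilibria m G 1 c).Finite ∧
      ∀ᵐ ω ∂P.μ, ∃ v ∈ equilibria m G 1 c, Tendsto (fun n => P.x n ω) atTop (𝓝 v) := by
  have hNn : 0 < G.edgeFinset.card := by
    rcases Nat.eq_zero_or_pos G.edgeFinset.card with h | h
    · rw [h] at hcN
      norm_num at hcN
      linarith
    · exact h
  have hN : 0 < (G.edgeFinset.card : ℝ) := by exact_mod_cast hNn
  have hfin := equilibria_finite G hc hN hconn hnbb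
  refine ⟨hfin, ?_⟩
  have hprob := P.isProb
  obtain ⟨ω₀⟩ : Nonempty P.Ω := P.μ.nonempty_of_neZero
  obtain ⟨S, hS⟩ : ∃ S, S = ∑ j, P.B 0 j ω₀ := ⟨_, rfl⟩
  have hSω : ∀ ω, ∑ j, P.B 0 j ω = S := fun ω => by
    rw [hS]
    exact Finset.sum_congr rfl fun j _ => P.B0_det j ω ω₀
  have hSpos : 0 < S := by
    obtain ⟨i0⟩ := hconn.nonempty
    have h1 := Finset.single_le_sum (f := fun j => P.B 0 j ω₀) (fun _ _ => Nat.zero_le _)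
      (Finset.mem_univ i0)
    have h2 := P.B0_pos i0 ω₀
    omega
  have hSR : (0 : ℝ) < S := by exact_mod_cast hSpos
  have hxdef : ∀ ω n i, P.x n ω i = (P.B n i ω : ℝ) / ((S : ℝ) + n * G.edgeFinset.card) := by
    intro ω n i
    simp only [GraphUrn.x]
    rw [hSω]
    push_cast
    rfl
  have htraj := fun ω => urn_traj G (b := fun n i => P.B n i ω) (d := fun n i j => P.δ n i j ω)
    hNn S hSpos (hSω ω) (fun i => P.B0_pos i ω) (fun n i j hij => P.δ_sum n i j hij ω)
    (fun n i => P.B_succ n i ω) (fun n => P.x n ω) (hxdef ω)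
  have hc0 : 0 < 1 / ((S : ℝ) + G.edgeFinset.card) := by positivity
  have hT : ∀ n : ℕ, 0 < (S : ℝ) + n * G.edgeFinset.card := fun n => by positivity
  have hsummable := summable_dissip G (μ := P.μ) P.ℱ (fun n i j ω => (P.δ n i j ω : ℝ)) P.x hc0
    (κ := (G.edgeFinset.card : ℝ) / ((S : ℝ) + G.edgeFinset.card)) (by positivity)
    (fun n : ℕ => (G.edgeFinset.card : ℝ) / ((S : ℝ) + (n + 1) * G.edgeFinset.card))
    (fun n => by
      rw [div_div]
      apply div_le_div_of_nonneg_left hN.le (by positivity)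
      nlinarith [mul_nonneg (Nat.cast_nonneg n : (0 : ℝ) ≤ n) hSR.le])
    hN
    (fun n i => by
      simp only [hxdef]
      exact ((measurable_from_top (f := fun k : ℕ => (k : ℝ))).comp (P.B_adapted n i)).div_const _)
    (fun n i j hij => by
      refine Integrable.of_bound (C := 1) ?_ (Eventually.of_forall fun ω => ?_)
      · exact ((measurable_from_top (f := fun k : ℕ => (k : ℝ))).comp
          ((P.δ_adapted n i j).mono (P.ℱ.le n) le_rfl)).aestronglyMeasurable
      · have h1 := P.δ_sum n i j hij ω
        have h2 : P.δ n i j ω ≤ 1 := by omega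
        simpa using h2)
    (fun n ω => (htraj ω).1 n) (fun n ω i => (htraj ω).2.2.1 n i)
    (fun n ω i => (htraj ω).2.1 n i)
    (fun n i j hij => by
      refine (P.cond_law n i j hij).trans (Eventually.of_forall fun ω => ?_)
      have h1 := hT n
      simp only [Real.rpow_one, hxdef]
      rw [← add_div, div_div_div_cancel_right₀ h1.ne'])
  filter_upwards [hsummable] with ω hω
  obtain ⟨hK, -, hst, hev⟩ := htraj ω
  have hdist : ∀ n, dist (P.x (n + 1) ω) (P.x n ω) ≤ 1 / ((n : ℝ) + 1) := by
    intro n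
    rw [dist_pi_le_iff (by positivity)]
    intro i
    rw [Real.dist_eq]
    exact hst n i
  have hD := tendsto_zero_of_summable (isCompact_simplexDomain G _) (continuousOn_dissip G hc0)
    (fun y hy => dissip_nonneg G hy) hK hdist hω
  exact conv_of_finite_zeros (isCompact_simplexDomain G c) (continuousOn_dissip G hc)
    (fun y hy => dissip_nonneg G hy) (fun y hy h => mem_equilibria_of_dissip G hy h) hfin
    (hev c hcN)
    (squeeze_zero (fun n => dist_nonneg) hdist tendsto_one_div_add_atTop_nhds_zero_nat) hD
end
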